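/- Let n = 2r be an even integer with n ≥ 4 and let F be a field with char F = 0 or char F > r. Then F[V] is spanned over F by the set of elements [T], where T ranges over all symplectic standard even-tableaux (including the empty tableau, with [T] = 1). -/

import Mathlib

open scoped Matrix

noncomputable section

namespace PR

/-- The polynomial ring `R[Y_{ij} : 1 ≤ i, j ≤ n]`, `n = 2r`. -/
abbrev PolyRing (r : ℕ) (R : Type*) [CommRing R] :=
  MvPolynomial (Fin (2 * r) × Fin (2 * r)) R

/-- The standard symplectic form matrix `J` (`n = 2r`). -/
def Jmat (r : ℕ) (R : Type*) [CommRing R] : Matrix (Fin (2 * r)) (Fin (2 * r)) R :=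
  Matrix.of fun i j =>
    if (j : ℕ) = (i : ℕ) + r then 1 else if (i : ℕ) = (j : ℕ) + r then -1 else 0

/-- The generic `n × n` matrix of indeterminates. -/
def Ygen (r : ℕ) (R : Type*) [CommRing R] :
    Matrix (Fin (2 * r)) (Fin (2 * r)) (MvPolynomial (Fin (2 * r) × Fin (2 * r)) R) :=
  Matrix.of fun i j => MvPolynomial.X (i, j)

/-- The defining ideal of the scheme `V`. -/
def VIdeal (r : ℕ) (R : Type*) [CommRing R] :
    Ideal (MvPolynomial (Fin (2 * r) × Fin (2 * r)) R) :=
  Ideal.span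
    ({p | ∃ i j, p = (Ygen r R + (Ygen r R)ᵀ) i j} ∪
     {p | ∃ i, p = Ygen r R i i} ∪
     {p | ∃ i j, p = ((Ygen r R)ᵀ * Jmat r (PolyRing r R) * Ygen r R) i j} ∪
     {p | ∃ k, p = (Matrix.charpoly (-(Jmat r (PolyRing r R) * Ygen r R)) - Polynomial.X ^ (2 * r)).coeff k})

/-- The coordinate ring `R[V]`. -/
abbrev FV (r : ℕ) (R : Type*) [CommRing R] :=
  MvPolynomial (Fin (2 * r) × Fin (2 * r)) R ⧸ VIdeal r R

/-- The pfaffian of an `m × m` matrix (nonzero only for even `m`), defined as a signed sum over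
permutations `σ` with `σ(2i-1) < σ(2i)` for each pair and `σ(1) < σ(3) < ⋯` (here 0-indexed). -/
def pf {m : ℕ} {R : Type*} [CommRing R] (A : Matrix (Fin m) (Fin m) R) : R :=
  ∑ σ ∈ Finset.univ.filter (fun σ : Equiv.Perm (Fin m) =>
      (∀ i : Fin (m / 2),
        σ ⟨2 * i.val, by have := i.isLt; omega⟩ < σ ⟨2 * i.val + 1, by have := i.isLt; omega⟩) ∧
      ∀ i j : Fin (m / 2), i < j →
        σ ⟨2 * i.val, by have := i.isLt; omega⟩ < σ ⟨2 * j.val, by have := j.isLt; omega⟩),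
    (Equiv.Perm.sign σ : ℤ) •
      ∏ i : Fin (m / 2),
        A (σ ⟨2 * i.val, by have := i.isLt; omega⟩) (σ ⟨2 * i.val + 1, by have := i.isLt; omega⟩)

/-- `[i₁, …, i₂ₗ]`: the pfaffian of the submatrix of `Y` given by a list of indices. -/
def listPf {n : ℕ} {R : Type*} [CommRing R] (Y : Matrix (Fin n) (Fin n) R)
    (L : List (Fin n)) : R :=
  pf (Matrix.of fun a b : Fin L.length => Y (L.get a) (L.get b))

/-- The product of pfaffians associated to a tableau (rows as lists of entries),
as a polynomial. -/
def tabPoly (r : ℕ) (R : Type*) [CommRing R] (T : List (List (Fin (2 * r)))) :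
    MvPolynomial (Fin (2 * r) × Fin (2 * r)) R :=
  (T.map (listPf (Ygen r R))).prod

/-- `[T]`, the class of the product of pfaffians of the rows of `T` in `R[V]`. -/
def tabElem (r : ℕ) (R : Type*) [CommRing R] (T : List (List (Fin (2 * r)))) : FV r R :=
  Ideal.Quotient.mk (VIdeal r R) (tabPoly r R T)

/-- Position of an index in the order `1̄ ≺ 1 ≺ 2̄ ≺ 2 ≺ ⋯ ≺ r̄ ≺ r`, where `ī := r + i`
(0-indexed: `ī` is `r + i - 1` and `i` is `i - 1`). -/
def ordIdx (r : ℕ) (x : Fin (2 * r)) : ℕ :=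
  if x.val < r then 2 * x.val + 1 else 2 * (x.val - r)

/-- A list of rows represents a tableau of shape a partition: row lengths weakly decreasing
and positive. -/
def IsShape {α : Type*} (T : List (List α)) : Prop :=
  (T.map List.length).Chain' (fun a b => b ≤ a) ∧ ∀ row ∈ T, row ≠ []

/-- An even-tableau: every row has even length. -/
def IsEvenTab {α : Type*} (T : List (List α)) : Prop :=
  ∀ row ∈ T, Even row.length

/-- Standard: entries strictly increase along each row and weakly increase down each column,
with respect to the order `≺`. -/
def IsStandard (r : ℕ) (T : List (List (Fin (2 * r)))) : Prop :=
  (∀ row ∈ T, row.Chain' (fun a b => ordIdx r a < ordIdx r b)) ∧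
  ∀ (i t : ℕ) (hi : i + 1 < T.length) (ht' : t < (T[i]'(Nat.lt_of_succ_lt hi)).length)
    (ht : t < (T[i + 1]'hi).length),
    ordIdx r ((T[i]'(Nat.lt_of_succ_lt hi))[t]'ht') ≤ ordIdx r ((T[i + 1]'hi)[t]'ht)

/-- The symplectic condition: the entries `p` and `p̄` (0-indexed: values `p` and `r + p`
for `p < r`) occur only in the first `p + 1` columns (0-indexed: columns `t ≤ p`). -/
def IsSymplectic (r : ℕ) (T : List (List (Fin (2 * r)))) : Prop :=
  ∀ (i t : ℕ) (hi : i < T.length) (ht : t < (T[i]'hi).length) (p : ℕ), p < r →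
    (((T[i]'hi)[t]'ht).val = p ∨ ((T[i]'hi)[t]'ht).val = r + p) → t ≤ p

/-- A symplectic standard even-tableau. -/
def IsSSET (r : ℕ) (T : List (List (Fin (2 * r)))) : Prop :=
  IsShape T ∧ IsEvenTab T ∧ IsStandard r T ∧ IsSymplectic r T

/-- A canonical tableau: in column `j` only `j̄` appears (0-indexed: column `t` contains
only the value `r + t`). -/
def IsCanonical (r : ℕ) (T : List (List (Fin (2 * r)))) : Prop :=
  ∀ (i t : ℕ) (hi : i < T.length) (ht : t < (T[i]'hi).length), ((T[i]'hi)[t]'ht).val = r + t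

/-- The set `V(C)` of matrices. -/
def MemV (r : ℕ) {C : Type*} [CommRing C] (Y : Matrix (Fin (2 * r)) (Fin (2 * r)) C) : Prop :=
  Y = -Yᵀ ∧ (∀ i, Y i i = 0) ∧ Yᵀ * Jmat r C * Y = 0 ∧
    Matrix.charpoly (-(Jmat r C * Y)) = Polynomial.X ^ (2 * r)

/-- The embedding `i ↦ i` of `{1, …, r}` into `{1, …, n}`. -/
def emb (r : ℕ) (i : Fin r) : Fin (2 * r) := ⟨i.val, by have := i.isLt; omega⟩

/-- The embedding `i ↦ ī = r + i` of `{1, …, r}` into `{1, …, n}`. -/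
def embBar (r : ℕ) (i : Fin r) : Fin (2 * r) := ⟨r + i.val, by have := i.isLt; omega⟩

/-- The index list of `[P, Q̄]`: with `Γ₀ = P ∩ Q = {γ₁ < ⋯ < γ_λ}`, the list
`γ₁, γ̄₁, …, γ_λ, γ̄_λ` followed by `P ∖ Γ₀` in increasing order and then the bars of
`Q ∖ Γ₀` in increasing order. -/
def pqList (r : ℕ) (P Q : Finset (Fin r)) : List (Fin (2 * r)) :=
  ((P ∩ Q).sort (· ≤ ·)).flatMap (fun γ => [emb r γ, embBar r γ]) ++
    ((P \ Q).sort (· ≤ ·)).map (emb r) ++ ((Q \ P).sort (· ≤ ·)).map (embBar r)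

/-- The pfaffian `[P, Q̄]` of the matrix `Y`. -/
def pfPQ (r : ℕ) {C : Type*} [CommRing C] (Y : Matrix (Fin (2 * r)) (Fin (2 * r)) C)
    (P Q : Finset (Fin r)) : C :=
  listPf Y (pqList r P Q)

/-- The defining ideal of the scheme `W`. -/
def WIdeal (r : ℕ) (R : Type*) [CommRing R] : Ideal (PolyRing r R) :=
  Ideal.span
    ({p | ∃ i j, p = (Jmat r (PolyRing r R) * (Ygen r R)ᵀ * Jmat r (PolyRing r R)
            + Ygen r R) i j} ∪
     {p | ∃ i j, p = (Ygen r R * Ygen r R) i j} ∪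
     {p | ∃ k, p = (Matrix.charpoly (Ygen r R) - Polynomial.X ^ (2 * r)).coeff k})

/-- The coordinate ring `R[W]`. -/
abbrev FW (r : ℕ) (R : Type*) [CommRing R] := PolyRing r R ⧸ WIdeal r R

section Wick

variable {R M α : Type*} [CommRing R] [AddCommGroup M] [Module R M]

/-- The product `v a₁ ∧ ⋯ ∧ v aₘ` in the exterior algebra, for a list `a₁, …, aₘ` of labels. -/
def wedge (v : α → M) (L : List α) : ExteriorAlgebra R M :=
  (L.map fun a => ExteriorAlgebra.ι R (v a)).prod

@[simp] theorem wedge_nil (v : α → M) : wedge (R := R) v [] = 1 := rfl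

@[simp] theorem wedge_cons (v : α → M) (a : α) (L : List α) :
    wedge (R := R) v (a :: L) = ExteriorAlgebra.ι R (v a) * wedge v L := by
  simp [wedge]

theorem wedge_append (v : α → M) (L L' : List α) :
    wedge (R := R) v (L ++ L') = wedge v L * wedge v L' := by
  simp [wedge]

theorem wedge_perm (v : α → M) {L L' : List α} (h : L.Perm L') :
    wedge (R := R) v L = wedge v L' ∨ wedge (R := R) v L = -wedge v L' := by
  induction h with
  | nil => simp
  | cons x _ ih =>
    rcases ih with ih | ih
    · left; simp [ih]
    · right; simp [ih]
  | swap x y l =>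
    right
    have := ExteriorAlgebra.ι_add_mul_swap (R := R) (v x) (v y)
    simp only [wedge_cons, ← mul_assoc]
    rw [← neg_mul]
    congr 1
    rw [← sub_eq_zero, sub_neg_eq_add, add_comm, this]
  | trans _ _ ih1 ih2 =>
    rcases ih1 with h1 | h1 <;> rcases ih2 with h2 | h2 <;> simp [h1, h2]

theorem wedge_eq_zero_of_not_nodup (v : α → M) {L : List α} (h : ¬ L.Nodup) :
    wedge (R := R) v L = 0 := by
  obtain ⟨x, hx⟩ := List.exists_duplicate_iff_not_nodup.2 h
  have hsub := List.duplicate_iff_sublist.1 hx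
  obtain ⟨L', hL'⟩ := hsub.exists_perm_append
  have : wedge (R := R) v ([x, x] ++ L') = 0 := by
    simp [← mul_assoc]
  rcases wedge_perm (R := R) v hL' with h | h <;> rw [h, this]
  simp

theorem contractLeft_wedge (d : Module.Dual R M) (v : α → M) (L : List α) :
    CliffordAlgebra.contractLeft d (wedge (R := R) v L) =
      ∑ i : Fin L.length, ((-1) ^ (i : ℕ) * d (v L[i])) • wedge (R := R) v (L.eraseIdx i) := by
  induction L with
  | nil => simp [wedge]
  | cons a L ih =>
    rw [wedge_cons, CliffordAlgebra.contractLeft_ι_mul, ih]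
    refine Eq.trans ?_ (Fin.sum_univ_succ (n := L.length) _).symm
    rw [Finset.mul_sum, sub_eq_add_neg, ← Finset.sum_neg_distrib]
    simp [pow_succ]

/-- The functional on the exterior algebra whose value on a wedge of vectors is the pfaffian of
their Gram matrix with respect to the alternating form `B`. -/
def pfaffian (B : LinearMap.BilinForm R M) (hB : B.IsAlt) : ExteriorAlgebra R M →ₗ[R] R :=
  (ExteriorAlgebra.algebraMapInv (R := R) (M := M)).toLinearMap ∘ₗ
    CliffordAlgebra.changeForm (Q := 0) (Q' := 0) (B := -B) (by ext x; simp [hB x])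

variable (B : LinearMap.BilinForm R M) (hB : B.IsAlt)

@[simp] theorem pfaffian_one : pfaffian B hB 1 = 1 := by
  simp [pfaffian, CliffordAlgebra.changeForm_one]

theorem pfaffian_ι_mul (m : M) (x : ExteriorAlgebra R M) :
    pfaffian B hB (ExteriorAlgebra.ι R m * x) =
      pfaffian B hB (CliffordAlgebra.contractLeft (B m) x) := by
  have h0 : ∀ y : ExteriorAlgebra R M,
      ExteriorAlgebra.algebraMapInv (ExteriorAlgebra.ι R m * y) = 0 := by
    intro y
    rw [map_mul]
    simp [ExteriorAlgebra.algebraMapInv]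
  simp only [pfaffian, LinearMap.comp_apply]
  rw [CliffordAlgebra.changeForm_ι_mul, CliffordAlgebra.changeForm_contractLeft]
  simp [h0]

/-- The pfaffian of the Gram matrix of a list of (labelled) vectors. -/
def gramPf (v : α → M) (L : List α) : R := pfaffian B hB (wedge v L)

@[simp] theorem gramPf_nil (v : α → M) : gramPf B hB v [] = 1 := by simp [gramPf]

theorem gramPf_cons (v : α → M) (a : α) (L : List α) :
    gramPf B hB v (a :: L) = ∑ i : Fin L.length,
      ((-1) ^ (i : ℕ) * B (v a) (v L[i])) * gramPf B hB v (L.eraseIdx i) := by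
  simp only [gramPf, wedge_cons, pfaffian_ι_mul, contractLeft_wedge, map_sum, map_smul,
    smul_eq_mul]

theorem gramPf_perm (v : α → M) {L L' : List α} (h : L.Perm L') :
    gramPf B hB v L = gramPf B hB v L' ∨ gramPf B hB v L = -gramPf B hB v L' := by
  rcases wedge_perm (R := R) v h with h | h <;> simp [gramPf, h]

theorem gramPf_eq_zero_of_not_nodup (v : α → M) {L : List α} (h : ¬ L.Nodup) :
    gramPf B hB v L = 0 := by
  simp [gramPf, wedge_eq_zero_of_not_nodup v h]

theorem gramPf_map {R' M' α' : Type*} [CommRing R'] [AddCommGroup M'] [Module R' M']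
    (B' : LinearMap.BilinForm R' M') (hB' : B'.IsAlt) (f : R →+* R') (g : α → α')
    (v : α → M) (v' : α' → M') (hv : ∀ x y, B' (v' (g x)) (v' (g y)) = f (B (v x) (v y)))
    (L : List α) :
    gramPf B' hB' v' (L.map g) = f (gramPf B hB v L) := by
  induction hn : L.length using Nat.strong_induction_on generalizing L with
  | _ n ih =>
    cases L with
    | nil => simp
    | cons a L =>
      rw [List.map_cons, gramPf_cons, gramPf_cons, map_sum]
      refine Fintype.sum_equiv (finCongr (by simp)) _ _ fun i => ?_
      have h1 : ((L.map g).eraseIdx (i : ℕ)) = (L.eraseIdx i).map g := by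
        rw [List.eraseIdx_map]
      have hi : (i : ℕ) < L.length := by have := i.2; simpa using this
      have h2 := ih (L.eraseIdx i).length (by
        rw [List.length_eraseIdx_of_lt hi, ← hn, List.length_cons]; omega) (L.eraseIdx i) rfl
      simp [h1, h2, hv]

theorem gramPf_append (v : α → M) (L L' : List α)
    (h : ∀ x ∈ L, ∀ y ∈ L', B (v x) (v y) = 0) :
    gramPf B hB v (L ++ L') = gramPf B hB v L * gramPf B hB v L' := by
  induction hn : L.length using Nat.strong_induction_on generalizing L with
  | _ n ih =>
    cases L with
    | nil => simp
    | cons a L =>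
      rw [List.cons_append, gramPf_cons, gramPf_cons, Finset.sum_mul]
      refine (Fintype.sum_equiv (finCongr (List.length_append (as := L) (bs := L'))) _
        (fun i => ((-1) ^ (i : ℕ) * B (v a) (v ((L ++ L')[(i : ℕ)]'(by simp)))) *
          gramPf B hB v ((L ++ L').eraseIdx i)) (fun i => rfl)).trans ?_
      rw [Fin.sum_univ_add]
      rw [Finset.sum_eq_zero (s := (Finset.univ : Finset (Fin L'.length))), add_zero]
      · refine Finset.sum_congr rfl fun i _ => ?_
        have h1 : (L ++ L').eraseIdx i = L.eraseIdx i ++ L' :=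
          List.eraseIdx_append_of_lt_length i.2 _
        have h2 := ih (L.eraseIdx i).length (by
          rw [List.length_eraseIdx_of_lt i.2, ← hn, List.length_cons]; omega) (L.eraseIdx i)
          (fun x hx => h x (List.mem_cons_of_mem _ (List.mem_of_mem_eraseIdx hx))) rfl
        simp [h1, h2, mul_assoc]
      · intro i _
        have := h a (by simp) L'[i] (by simp)
        simp at this
        simp [this]

theorem pow_dvd_gramPf (v : α → M) (p : α → Bool) (q : R)
    (h : ∀ x y, p x → p y → q ∣ B (v x) (v y)) (L : List α) (m : ℕ)
    (hm : L.countP (fun x => !p x) + 2 * m ≤ L.countP p) :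
    q ^ m ∣ gramPf B hB v L := by
  induction hn : L.length using Nat.strong_induction_on generalizing L m with
  | _ n ih =>
    cases m with
    | zero => simp
    | succ m =>
      cases L with
      | nil => simp at hm
      | cons a L =>
        rw [gramPf_cons]
        refine Finset.dvd_sum fun i _ => ?_
        have hperm := List.getElem_cons_eraseIdx_perm i.2
        have c1 := hperm.countP_eq p
        have c2 := hperm.countP_eq (fun x => !p x)
        have hlt : (L.eraseIdx i).length < n := by
          rw [List.length_eraseIdx_of_lt i.2, ← hn, List.length_cons]; omega
        rw [List.countP_cons] at c1 c2
        rw [List.countP_cons, List.countP_cons] at hm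
        by_cases ha : p a <;> by_cases hi : p L[(i:ℕ)]
        · rw [pow_succ']
          refine mul_dvd_mul (Dvd.dvd.mul_left (h _ _ ha hi) _) (ih _ hlt _ m ?_ rfl)
          simp only [ha, hi] at hm c1 c2
          simp at hm c1 c2
          omega
        · refine Dvd.dvd.mul_left (ih _ hlt _ (m + 1) ?_ rfl) _
          simp only [ha, hi] at hm c1 c2
          simp at hm c1 c2
          omega
        · refine Dvd.dvd.mul_left (ih _ hlt _ (m + 1) ?_ rfl) _
          simp only [ha, hi] at hm c1 c2
          simp at hm c1 c2
          omega
        · refine Dvd.dvd.mul_left (ih _ hlt _ (m + 1) ?_ rfl) _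
          simp only [ha, hi] at hm c1 c2
          simp at hm c1 c2
          omega

theorem gramPf_of_odd (v : α → M) (L : List α) (h : Odd L.length) : gramPf B hB v L = 0 := by
  induction hn : L.length using Nat.strong_induction_on generalizing L with
  | _ n ih =>
    cases L with
    | nil => simp at h
    | cons a L =>
      rw [gramPf_cons]
      refine Finset.sum_eq_zero fun i _ => ?_
      have hl := List.length_eraseIdx_of_lt i.2
      rw [ih (L.eraseIdx i).length (by simp at hn; omega) _ ?_ rfl, mul_zero]
      rw [hl]
      have := i.2
      obtain ⟨k, hk⟩ := h
      simp at hk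
      exact ⟨k - 1, by omega⟩

end Wick

section Window

open Polynomial

variable {R : Type*} [CommRing R]

/-- If all the coefficients of a multiple of `(X ^ 2 + 1) ^ N` lie in `K`, except possibly those
in the positions `j, j - 2, …, j - 2 (N - 1)`, then all of its coefficients lie in `K`. -/
theorem coeff_mem_of_window (K : AddSubgroup R) (N : ℕ) (j : ℕ) (G : R[X])
    (hG : (X ^ 2 + 1) ^ N ∣ G)
    (h : ∀ k, (¬ ∃ i < N, k + 2 * i = j) → G.coeff k ∈ K) (k : ℕ) : G.coeff k ∈ K := by
  induction N generalizing j G k with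
  | zero => exact h k (by simp)
  | succ N ih =>
    obtain ⟨H, rfl⟩ := hG
    set G' := (X ^ 2 + 1) ^ N * H with hG'
    have hGG : (X ^ 2 + 1) ^ (N + 1) * H = G' * X ^ 2 + G' := by rw [hG']; ring
    rw [hGG] at h ⊢
    have c0 : ∀ k, k < 2 → (G' * X ^ 2 + G').coeff k = G'.coeff k := by
      intro k hk
      rw [coeff_add, coeff_mul_X_pow']
      simp [show ¬ 2 ≤ k by omega]
    have c2 : ∀ k, (G' * X ^ 2 + G').coeff (k + 2) = G'.coeff k + G'.coeff (k + 2) := by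
      intro k
      rw [coeff_add, coeff_mul_X_pow]
    have above : ∀ e k, G'.natDegree < k + e → j < k + 2 → G'.coeff k ∈ K := by
      intro e
      induction e using Nat.strong_induction_on with
      | _ e ihe =>
        intro k hk hjk
        rcases Nat.lt_or_ge G'.natDegree k with h1 | h1
        · rw [coeff_eq_zero_of_natDegree_lt h1]; exact K.zero_mem
        · have h3 := h (k + 2) (by rintro ⟨i, _, hi⟩; omega)
          rw [c2] at h3
          have h4 : G'.coeff (k + 2) ∈ K := by
            rcases Nat.lt_or_ge G'.natDegree (k + 2) with h5 | h5
            · rw [coeff_eq_zero_of_natDegree_lt h5]; exact K.zero_mem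
            · exact ihe (e - 2) (by omega) (k + 2) (by omega) (by omega)
          exact (K.add_mem_cancel_right h4).1 h3
    have below : ∀ k, (¬ ∃ i < N + 1, k + 2 * i = j) → k ≤ j → G'.coeff k ∈ K := by
      intro k
      induction k using Nat.strong_induction_on with
      | _ k ihk =>
        intro hk hkj
        have h3 := h k hk
        rcases Nat.lt_or_ge k 2 with h1 | h1
        · rwa [c0 k h1] at h3
        · obtain ⟨k, rfl⟩ := Nat.exists_eq_add_of_le' h1
          rw [c2] at h3
          refine (K.add_mem_cancel_left (ihk k (by omega) ?_ (by omega))).1 h3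
          rintro ⟨i, hi, hi2⟩
          exact hk ⟨i - 1, by omega, by omega⟩
    have all : ∀ k, G'.coeff k ∈ K := by
      rcases Nat.lt_or_ge j 2 with hj | hj
      · intro k
        exact above (G'.natDegree + 1) k (by omega) (by omega)
      · refine fun k => ih (j - 2) G' (Dvd.intro _ rfl) (fun k hk => ?_) k
        rcases Nat.lt_or_ge j (k + 2) with h1 | h1
        · exact above (G'.natDegree + 1) k (by omega) h1
        · refine below k ?_ (by omega)
          rintro ⟨i, hi, hi2⟩
          exact hk ⟨i - 1, by omega, by omega⟩
    rcases Nat.lt_or_ge k 2 with h1 | h1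
    · rw [c0 k h1]; exact all k
    · obtain ⟨k, rfl⟩ := Nat.exists_eq_add_of_le' h1
      rw [c2]; exact K.add_mem (all _) (all _)

end Window

section Matrices

variable {R α : Type*} [CommRing R]

/-- A square matrix is alternating if it is skew-symmetric with zero diagonal. -/
def IsAltMatrix (A : Matrix α α R) : Prop := (∀ i j, A i j = -A j i) ∧ ∀ i, A i i = 0

variable [Fintype α] [DecidableEq α]

theorem IsAltMatrix.isAlt {A : Matrix α α R} (hA : IsAltMatrix A) :
    (Matrix.toBilin' A).IsAlt := by
  intro x
  rw [Matrix.toBilin'_apply, ← Finset.sum_product']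
  refine Finset.sum_involution (fun p _ => p.swap) ?_ ?_ ?_ ?_
  · rintro ⟨i, j⟩ -
    simp only [Prod.fst_swap, Prod.snd_swap]
    rw [hA.1 j i]; ring
  · rintro ⟨i, j⟩ - h heq
    apply h
    simp only [Prod.swap_prod_mk, Prod.mk.injEq] at heq
    simp [heq.1, hA.2]
  · simp
  · simp

/-- The pfaffian of the rows and columns of an alternating matrix indexed by a list. -/
def altPf {A : Matrix α α R} (hA : IsAltMatrix A) (L : List α) : R :=
  gramPf (Matrix.toBilin' A) hA.isAlt (fun a => Pi.single a 1) L

/-- The sublist of `C 0, …, C (c - 1)` on the positions in `s`. -/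
def select {c : ℕ} (C : Fin c → α) (s : Finset (Fin c)) : List α :=
  ((List.finRange c).filter (· ∈ s)).map C

omit [Fintype α] [DecidableEq α] in
theorem length_select {c : ℕ} (C : Fin c → α) (s : Finset (Fin c)) :
    (select C s).length = s.card := by
  rw [select, List.length_map, ← List.toFinset_card_of_nodup ((List.nodup_finRange c).filter _)]
  congr 1
  ext; simp

end Matrices

section Exchange

open Polynomial

variable {R α : Type*} [CommRing R] [Fintype α] [DecidableEq α]

omit [Fintype α] [DecidableEq α] in
theorem gramPf_pair {M : Type*} [AddCommGroup M] [Module R M] (B : LinearMap.BilinForm R M)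
    (hB : B.IsAlt) (v : Bool × α → M) (hv : ∀ x y, B (v (true, x)) (v (false, y)) = 0)
    (L : List (Bool × α)) : ∃ ε : R, (ε = 1 ∨ ε = -1) ∧ gramPf B hB v L =
      ε * (gramPf B hB v (((L.filter fun x => x.1).map Prod.snd).map (Prod.mk true)) *
        gramPf B hB v (((L.filter fun x => !x.1).map Prod.snd).map (Prod.mk false))) := by
  have h1 : ((L.filter fun x => x.1).map Prod.snd).map (Prod.mk true) =
      L.filter fun x => x.1 := by
    rw [List.map_map]
    conv_rhs => rw [← List.map_id (L.filter fun x => x.1)]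
    refine List.map_congr_left fun x hx => ?_
    have := (List.mem_filter.1 hx).2
    exact Prod.ext this.symm rfl
  have h2 : ((L.filter fun x => !x.1).map Prod.snd).map (Prod.mk false) =
      L.filter fun x => !x.1 := by
    rw [List.map_map]
    conv_rhs => rw [← List.map_id (L.filter fun x => !x.1)]
    refine List.map_congr_left fun x hx => ?_
    have := (List.mem_filter.1 hx).2
    exact Prod.ext (by simpa using this.symm) rfl
  have h3 := gramPf_append B hB v (L.filter fun x => x.1) (L.filter fun x => !x.1) (by
    rintro ⟨x, a⟩ hx ⟨y, b⟩ hy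
    have hx := (List.mem_filter.1 hx).2
    have hy := (List.mem_filter.1 hy).2
    simp only [Bool.not_eq_eq_eq_not, Bool.not_true] at hx hy
    subst hx hy
    exact hv a b)
  rw [h1, h2, ← h3]
  rcases gramPf_perm B hB v (List.filter_append_perm (fun x => x.1) L).symm with h | h
  · exact ⟨1, Or.inl rfl, by rw [h, one_mul]⟩
  · exact ⟨-1, Or.inr rfl, by rw [h, neg_one_mul]⟩

/-- A generating function for the shuffled products of two pfaffians, and its divisibility. -/
theorem exists_shuffle_polynomial {A : Matrix α α R} (hA : IsAltMatrix A) (a b : List α) {c : ℕ}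
    (C : Fin c → α) : ∃ (G : R[X]) (ε : Finset (Fin c) → R), (∀ s, ε s = 1 ∨ ε s = -1) ∧
      (∀ m, a.length + b.length + 2 * m ≤ c → (X ^ 2 + 1) ^ m ∣ G) ∧
      ∀ j, G.coeff j = ∑ s : Finset (Fin c) with s.card = j,
        ε s * (altPf hA (a ++ select C s) * altPf hA (select C sᶜ ++ b)) := by
  classical
  let A' : Matrix (α ⊕ α) (α ⊕ α) R[X] := Matrix.fromBlocks (A.map Polynomial.C) 0 0
    (A.map Polynomial.C)
  have hA' : IsAltMatrix A' := by
    constructor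
    · rintro (i | i) (j | j) <;> simp [A', hA.1 i j]
    · rintro (i | i) <;> simp [A', hA.2 i]
  set B' := Matrix.toBilin' A' with hB'
  have hB'' : B'.IsAlt := hA'.isAlt
  let e : Bool × α → (α ⊕ α → R[X]) :=
    fun x => if x.1 then Pi.single (Sum.inl x.2) 1 else Pi.single (Sum.inr x.2) 1
  let d : α → (α ⊕ α → R[X]) := fun x => (X : R[X]) • e (true, x) + e (false, x)
  have he : ∀ x y, B' (e x) (e y) = if x.1 = y.1 then Polynomial.C (A x.2 y.2) else 0 := by
    rintro ⟨x, i⟩ ⟨y, j⟩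
    cases x <;> cases y <;> simp [e, hB', A', Matrix.toBilin'_single]
  have hd : ∀ x y, B' (d x) (d y) = (X ^ 2 + 1) * Polynomial.C (A x y) := by
    intro x y
    simp only [d, map_add, map_smul, LinearMap.add_apply, LinearMap.smul_apply, he]
    simp
    ring
  let w : Option Bool × α → (α ⊕ α → R[X]) := fun x =>
    match x.1 with
    | none => d x.2
    | some t => e (t, x.2)
  let f : MultilinearMap R[X] (fun _ : Fin c => (α ⊕ α → R[X])) R[X] :=
    (pfaffian B' hB'' ∘ₗ (LinearMap.mulLeft R[X] (wedge e (a.map (Prod.mk true)))) ∘ₗ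
      (LinearMap.mulRight R[X] (wedge e (b.map (Prod.mk false))))).compMultilinearMap
      (ExteriorAlgebra.ιMulti R[X] c).toMultilinearMap
  have hf : ∀ g : Fin c → Bool × α, f (fun i => e (g i)) =
      gramPf B' hB'' e (a.map (Prod.mk true) ++ List.ofFn g ++ b.map (Prod.mk false)) := by
    intro g
    simp [f, gramPf, ExteriorAlgebra.ιMulti_apply, wedge, List.map_ofFn, Function.comp_def]
  have hfd : f (fun i => d (C i)) = gramPf B' hB'' w
      (a.map (Prod.mk (some true)) ++ List.ofFn (fun i => (none, C i)) ++
        b.map (Prod.mk (some false))) := by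
    simp [f, gramPf, ExteriorAlgebra.ιMulti_apply, wedge, List.map_ofFn, Function.comp_def, w]
  have hpair := fun s : Finset (Fin c) => gramPf_pair B' hB'' e (by simp [he])
    (a.map (Prod.mk true) ++ List.ofFn (fun i => (decide (i ∈ s), C i)) ++ b.map (Prod.mk false))
  have hval : ∀ (t : Bool) (L : List α), gramPf B' hB'' e (L.map (Prod.mk t)) =
      Polynomial.C (altPf hA L) := by
    intro t L
    refine gramPf_map _ hA.isAlt B' hB'' Polynomial.C (Prod.mk t) _ e ?_ L
    intro x y
    simp [he, Matrix.toBilin'_single]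
  have hsel : ∀ s : Finset (Fin c), (((a.map (Prod.mk true) ++
      List.ofFn (fun i => (decide (i ∈ s), C i)) ++ b.map (Prod.mk false)).filter
        fun x => x.1).map Prod.snd) = a ++ select C s := by
    intro s
    simp [select, List.ofFn_eq_map, List.filter_map, Function.comp_def]
  have hsel' : ∀ s : Finset (Fin c), (((a.map (Prod.mk true) ++
      List.ofFn (fun i => (decide (i ∈ s), C i)) ++ b.map (Prod.mk false)).filter
        fun x => !x.1).map Prod.snd) = select C sᶜ ++ b := by
    intro s
    simp [select, List.ofFn_eq_map, List.filter_map, Function.comp_def]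
  have hpair' : ∀ s : Finset (Fin c), ∃ ε : R, (ε = 1 ∨ ε = -1) ∧
      gramPf B' hB'' e (a.map (Prod.mk true) ++ List.ofFn (fun i => (decide (i ∈ s), C i)) ++
        b.map (Prod.mk false)) = Polynomial.C
          (ε * (altPf hA (a ++ select C s) * altPf hA (select C sᶜ ++ b))) := by
    intro s
    obtain ⟨ε, hε, h⟩ := hpair s
    rw [hsel, hsel', hval, hval] at h
    rcases hε with rfl | rfl
    · exact ⟨1, Or.inl rfl, by rw [h]; simp⟩
    · exact ⟨-1, Or.inr rfl, by rw [h]; simp⟩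
  choose ε hε hpf using hpair'
  refine ⟨f (fun i => d (C i)), ε, hε, ?_, ?_⟩
  · intro m hm
    rw [hfd]
    refine pow_dvd_gramPf B' hB'' w (fun x => x.1.isNone) _ ?_ _ m ?_
    · rintro ⟨x, i⟩ ⟨y, j⟩ hx hy
      cases x <;> cases y <;> simp at hx hy
      exact ⟨_, hd i j⟩
    · simp only [List.countP_append, List.countP_map, List.ofFn_eq_map, Function.comp_def]
      simp
      omega
  · intro j
    have h1 : (fun i => d (C i)) =
        (fun i => (X : R[X]) • e (true, C i)) + (fun i => e (false, C i)) := rfl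
    rw [h1, f.map_add_univ, finsetSum_coeff, Finset.sum_filter]
    refine Finset.sum_congr rfl fun s _ => ?_
    have h2 : s.piecewise (fun i => (X : R[X]) • e (true, C i)) (fun i => e (false, C i)) =
        s.piecewise (fun i => (X : R[X]) • e (decide (i ∈ s), C i))
          (fun i => e (decide (i ∈ s), C i)) := by
      ext1 i
      by_cases hi : i ∈ s <;> simp [hi]
    rw [h2, f.map_piecewise_smul (fun _ => (X : R[X])), hf, hpf]
    simp only [Finset.prod_const, smul_eq_mul, coeff_X_pow_mul', coeff_C]
    by_cases hs : s.card = j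
    · simp [hs]
    · simp only [hs, if_false]
      split_ifs
      · omega
      · rfl
      · rfl

end Exchange

section Expansion

/-- The condition on permutations in the definition of `pf`. -/
def IsMatching {m : ℕ} (σ : Equiv.Perm (Fin m)) : Prop :=
  (∀ i (h : 2 * i + 1 < m), σ ⟨2 * i, by omega⟩ < σ ⟨2 * i + 1, h⟩) ∧
    ∀ i j (_ : i < j) (h : 2 * j + 1 < m), σ ⟨2 * i, by omega⟩ < σ ⟨2 * j, by omega⟩

open Classical in
theorem pf_eq_sum {m : ℕ} {R : Type*} [CommRing R] (A : Matrix (Fin m) (Fin m) R) :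
    pf A = ∑ σ : Equiv.Perm (Fin m) with IsMatching σ, (Equiv.Perm.sign σ : ℤ) •
      ∏ i : Fin (m / 2),
        A (σ ⟨2 * i.val, by have := i.isLt; omega⟩)
          (σ ⟨2 * i.val + 1, by have := i.isLt; omega⟩) := by
  rw [pf]
  refine Finset.sum_congr (Finset.filter_congr fun σ _ => ?_) fun _ _ => rfl
  constructor
  · rintro ⟨h1, h2⟩
    exact ⟨fun i h => h1 ⟨i, by omega⟩, fun i j hij h => h2 ⟨i, by omega⟩ ⟨j, by omega⟩ hij⟩
  · rintro ⟨h1, h2⟩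
    exact ⟨fun i => h1 i _, fun i j hij => h2 i j hij (by have := j.2; omega)⟩

/-- The permutation matching `0` with `j + 1` and the other indices according to `σ`. -/
def insertPair {m : ℕ} (j : Fin (m + 1)) (σ : Equiv.Perm (Fin m)) : Equiv.Perm (Fin (m + 2)) :=
  Equiv.Perm.decomposeFin.symm (0, j.cycleRange.symm * Equiv.Perm.decomposeFin.symm (0, σ))

variable {m : ℕ} (j : Fin (m + 1)) (σ : Equiv.Perm (Fin m))

theorem insertPair_zero : insertPair j σ 0 = 0 := by
  simp [insertPair]

theorem insertPair_one : insertPair j σ 1 = j.succ := by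
  rw [← Fin.succ_zero_eq_one, insertPair, Equiv.Perm.decomposeFin_symm_apply_succ]
  simp

theorem insertPair_succ_succ (i : Fin m) :
    insertPair j σ i.succ.succ = (j.succAbove (σ i)).succ := by
  rw [insertPair, Equiv.Perm.decomposeFin_symm_apply_succ]
  simp [Fin.cycleRange_symm_succ]

theorem insertPair_mk (i : ℕ) (h : i + 2 < m + 2) :
    insertPair j σ ⟨i + 2, h⟩ = (j.succAbove (σ ⟨i, by omega⟩)).succ :=
  insertPair_succ_succ j σ ⟨i, by omega⟩

theorem sign_insertPair :
    ((Equiv.Perm.sign (insertPair j σ) : ℤˣ) : ℤ) = (-1) ^ (j : ℕ) * Equiv.Perm.sign σ := by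
  rw [insertPair, Equiv.Perm.decomposeFin.symm_sign]
  simp [Fin.sign_cycleRange]

theorem insertPair_injective {j k : Fin (m + 1)} {σ τ : Equiv.Perm (Fin m)}
    (h : insertPair j σ = insertPair k τ) : j = k ∧ σ = τ := by
  have h1 : j = k := by
    have := congrArg (fun f : Equiv.Perm (Fin (m + 2)) => f 1) h
    simpa [insertPair_one] using this
  subst h1
  refine ⟨rfl, Equiv.ext fun i => ?_⟩
  have := congrArg (fun f : Equiv.Perm (Fin (m + 2)) => f i.succ.succ) h
  simpa [insertPair_succ_succ] using this

theorem isMatching_insertPair : IsMatching (insertPair j σ) ↔ IsMatching σ := by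
  constructor
  · rintro ⟨h1, h2⟩
    constructor
    · intro i h
      have := h1 (i + 1) (by omega)
      simpa [mul_add, insertPair_mk] using this
    · intro i k hik h
      have := h2 (i + 1) (k + 1) (by omega) (by omega)
      simpa [mul_add, insertPair_mk] using this
  · rintro ⟨h1, h2⟩
    constructor
    · intro i h
      cases i with
      | zero => simp [insertPair_zero, insertPair_one]
      | succ i =>
        have := h1 i (by omega)
        simpa [mul_add, insertPair_mk] using this
    · intro i k hik h
      obtain ⟨k, rfl⟩ : ∃ l, k = l + 1 := ⟨k - 1, by omega⟩
      cases i with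
      | zero => simp [mul_add, insertPair_mk, insertPair_zero]
      | succ i =>
        have := h2 i k (by omega) (by omega)
        simpa [mul_add, insertPair_mk] using this

theorem IsMatching.exists_insertPair (hm : Even m) {ρ : Equiv.Perm (Fin (m + 2))}
    (h : IsMatching ρ) : ∃ j σ, insertPair (m := m) j σ = ρ := by
  have h0 : ρ 0 = 0 := by
    obtain ⟨⟨k, hk⟩, hk0⟩ := ρ.surjective 0
    obtain ⟨i, rfl | rfl⟩ := Nat.even_or_odd' k
    · rcases Nat.eq_zero_or_pos i with rfl | hi
      · exact hk0
      · obtain ⟨l, rfl⟩ := hm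
        have := h.2 0 i hi (by omega)
        rw [hk0] at this
        exact absurd this (Fin.not_lt_zero _)
    · have := h.1 i hk
      rw [hk0] at this
      exact absurd this (Fin.not_lt_zero _)
  obtain ⟨⟨p, τ⟩, rfl⟩ := Equiv.Perm.decomposeFin.symm.surjective ρ
  have hp : p = 0 := by simpa using h0
  subst hp
  obtain ⟨⟨q, σ⟩, hσ⟩ := Equiv.Perm.decomposeFin.symm.surjective ((τ 0).cycleRange * τ)
  have hq : q = 0 := by
    have := congrArg (fun f : Equiv.Perm (Fin (m + 1)) => f 0) hσ
    simpa using this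
  subst hq
  refine ⟨τ 0, σ, ?_⟩
  rw [insertPair, hσ]
  congr 2
  ext i
  simp

theorem pf_succ_succ {R : Type*} [CommRing R] (hm : Even m)
    (A : Matrix (Fin (m + 2)) (Fin (m + 2)) R) :
    pf A = ∑ j : Fin (m + 1), ((-1) ^ (j : ℕ) * A 0 j.succ) *
      pf (A.submatrix (fun i => (j.succAbove i).succ) (fun i => (j.succAbove i).succ)) := by
  classical
  simp_rw [pf_eq_sum, Finset.mul_sum]
  rw [← Finset.sum_product']
  symm
  refine Finset.sum_nbij (fun x => insertPair x.1 x.2) ?_ ?_ ?_ ?_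
  · rintro ⟨j, σ⟩ h
    simpa [isMatching_insertPair] using h
  · rintro ⟨j, σ⟩ - ⟨k, τ⟩ - h
    obtain ⟨rfl, rfl⟩ := insertPair_injective h
    rfl
  · intro ρ hρ
    have hρ : IsMatching ρ := by simpa using hρ
    obtain ⟨j, σ, rfl⟩ := hρ.exists_insertPair hm
    exact ⟨(j, σ), by simpa [isMatching_insertPair] using hρ, rfl⟩
  · rintro ⟨j, σ⟩ -
    rw [sign_insertPair]
    have hprod := (Fintype.prod_equiv (finCongr (show (m + 2) / 2 = m / 2 + 1 by omega))
      (fun i => A (insertPair j σ ⟨2 * i.val, by have := i.isLt; omega⟩)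
        (insertPair j σ ⟨2 * i.val + 1, by have := i.isLt; omega⟩))
      (fun i : Fin (m / 2 + 1) => A (insertPair j σ ⟨2 * i.val, by have := i.isLt; omega⟩)
          (insertPair j σ ⟨2 * i.val + 1, by have := i.isLt; omega⟩)) (fun i => rfl)).trans
      (Fin.prod_univ_succ _)
    simp only [hprod]
    simp [mul_add, insertPair_mk, insertPair_zero, insertPair_one, Matrix.submatrix]
    ring

theorem pf_zero {R : Type*} [CommRing R] (A : Matrix (Fin 0) (Fin 0) R) : pf A = 1 := by
  simp [pf]

theorem pf_map {R R' : Type*} [CommRing R] [CommRing R'] (f : R →+* R') {k : ℕ}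
    (A : Matrix (Fin k) (Fin k) R) : pf (A.map f) = f (pf A) := by
  simp [pf, map_sum, map_prod]

theorem _root_.List.eraseIdx_ofFn {β : Type*} {k : ℕ} (g : Fin (k + 1) → β) (j : Fin (k + 1)) :
    (List.ofFn g).eraseIdx j = List.ofFn (g ∘ j.succAbove) := by
  refine List.ext_getElem ?_ fun i h1 h2 => ?_
  · rw [List.length_eraseIdx_of_lt (by simp; omega)]
    simp
  · rw [List.getElem_eraseIdx]
    simp only [List.length_ofFn] at h2
    by_cases hij : i < j
    · simp only [hij, dite_true, List.getElem_ofFn, Function.comp]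
      congr 1
      rw [Fin.succAbove_of_castSucc_lt _ _ (by simpa [Fin.lt_def] using hij)]
      rfl
    · simp only [hij, dite_false, List.getElem_ofFn, Function.comp]
      congr 1
      rw [Fin.succAbove_of_le_castSucc _ _ (by simpa [Fin.le_def] using hij)]
      rfl

theorem pf_eq_altPf {R α : Type*} [CommRing R] [Fintype α] [DecidableEq α]
    {Y : Matrix α α R} (hY : IsAltMatrix Y) (l : ℕ) (g : Fin (2 * l) → α) :
    pf (Matrix.of fun a b => Y (g a) (g b)) = altPf hY (List.ofFn g) := by
  induction l with
  | zero => simp [pf_zero, altPf]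
  | succ l ih =>
    rw [pf_succ_succ (m := 2 * l) (by simp)]
    have hofn : List.ofFn g = g 0 :: List.ofFn (fun i : Fin (2 * l + 1) => g i.succ) :=
      List.ofFn_succ (n := 2 * l + 1)
    rw [hofn, altPf, gramPf_cons]
    refine Fintype.sum_equiv (finCongr (by simp)) _ _ fun j => ?_
    have h1 : (List.ofFn (fun i : Fin (2 * l + 1) => g i.succ)).eraseIdx j = _ :=
      List.eraseIdx_ofFn _ j
    have h2 := ih (fun i => g (j.succAbove i).succ)
    rw [altPf] at h2
    simp only [finCongr_apply, Fin.val_cast, h1]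
    simp only [Matrix.toBilin'_single, Function.comp_def]
    rw [← h2]
    simp only [List.getElem_ofFn, Matrix.of_apply, Fin.getElem_fin, Fin.val_cast, Fin.eta]
    rfl

theorem listPf_eq_altPf {R : Type*} [CommRing R] {n : ℕ} {Y : Matrix (Fin n) (Fin n) R}
    (hY : IsAltMatrix Y) (L : List (Fin n)) (hL : Even L.length) :
    listPf Y L = altPf hY L := by
  obtain ⟨l, hl⟩ := even_iff_exists_two_mul.1 hL
  have key : ∀ k (g : Fin k → Fin n), k = 2 * l →
      pf (Matrix.of fun a b => Y (g a) (g b)) = altPf hY (List.ofFn g) := by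
    rintro k g rfl
    exact pf_eq_altPf hY l g
  rw [listPf, key _ L.get hl, List.ofFn_get]

end Expansion

section SymplecticRelation

open CliffordAlgebra

variable {R : Type*} [CommRing R] {r : ℕ}

theorem sum_emb_add_sum_embBar {β : Type*} [AddCommMonoid β] (f : Fin (2 * r) → β) :
    ∑ x, f x = ∑ i, f (emb r i) + ∑ i, f (embBar r i) := by
  rw [Fintype.sum_equiv (finCongr (two_mul r)) f (fun x => f (Fin.cast (two_mul r).symm x))
    (fun x => rfl), Fin.sum_univ_add]
  rfl

theorem Jmat_mulVec_emb (y : Fin (2 * r) → R) (i : Fin r) :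
    (Jmat r R *ᵥ y) (emb r i) = y (embBar r i) := by
  rw [Matrix.mulVec, dotProduct, Finset.sum_eq_single (embBar r i)]
  · simp [Jmat, emb, embBar, add_comm]
  · intro x _ hx
    have h1 : ¬ (x : ℕ) = i + r := fun h => hx (Fin.ext (by simp [embBar, h, add_comm]))
    have h2 : ¬ (i : ℕ) = x + r := by omega
    simp [Jmat, emb, h1, h2]
  · simp

theorem Jmat_mulVec_embBar (y : Fin (2 * r) → R) (i : Fin r) :
    (Jmat r R *ᵥ y) (embBar r i) = -y (emb r i) := by
  rw [Matrix.mulVec, dotProduct, Finset.sum_eq_single (emb r i)]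
  · simp [Jmat, emb, embBar, add_comm]
    intro h; omega
  · intro x _ hx
    have h1 : ¬ (x : ℕ) = r + i + r := by omega
    have h2 : ¬ r + (i : ℕ) = x + r := fun h => hx (Fin.ext (by simp [emb]; omega))
    simp [Jmat, embBar, h1, h2]
  · simp

variable {Y : Matrix (Fin (2 * r)) (Fin (2 * r)) R}

theorem toBilin'_single_left {α : Type*} [Fintype α] [DecidableEq α] (A : Matrix α α R) (i : α)
    (v : α → R) : Matrix.toBilin' A (Pi.single i 1) v = (A *ᵥ v) i := by
  rw [Matrix.toBilin'_apply']
  simp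

theorem sum_toBilin'_mul_sub (hJ : Yᵀ * Jmat r R * Y = 0) (v u : Fin (2 * r) → R) :
    ∑ i, ((Y *ᵥ v) (emb r i) * (Y *ᵥ u) (embBar r i) -
      (Y *ᵥ v) (embBar r i) * (Y *ᵥ u) (emb r i)) = 0 := by
  have h : (Y *ᵥ v) ⬝ᵥ (Jmat r R *ᵥ (Y *ᵥ u)) = 0 := by
    rw [← Matrix.vecMul_transpose, ← Matrix.dotProduct_mulVec, Matrix.mulVec_mulVec,
      Matrix.mulVec_mulVec, hJ]
    simp
  rw [dotProduct, sum_emb_add_sum_embBar] at h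
  simp only [Jmat_mulVec_emb, Jmat_mulVec_embBar] at h
  rw [← h, ← Finset.sum_add_distrib]
  exact Finset.sum_congr rfl fun i _ => by ring

theorem sum_contractLeft_contractLeft (hJ : Yᵀ * Jmat r R * Y = 0)
    (w : ExteriorAlgebra R (Fin (2 * r) → R)) :
    ∑ i, contractLeft (Matrix.toBilin' Y (Pi.single (embBar r i) 1))
      (contractLeft (Matrix.toBilin' Y (Pi.single (emb r i) 1)) w) = 0 := by
  induction w using CliffordAlgebra.left_induction with
  | algebraMap c => simp [contractLeft_algebraMap]
  | add x y hx hy =>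
    simp only [map_add, Finset.sum_add_distrib, hx, hy, add_zero]
  | ι_mul x v hx =>
    have hd : ∑ i, ((Y *ᵥ v) (emb r i) • Matrix.toBilin' Y (Pi.single (embBar r i) 1) -
        (Y *ᵥ v) (embBar r i) • Matrix.toBilin' Y (Pi.single (emb r i) 1)) = 0 := by
      refine LinearMap.ext fun u => ?_
      simpa only [LinearMap.sum_apply, LinearMap.sub_apply, LinearMap.smul_apply, smul_eq_mul,
        LinearMap.zero_apply, toBilin'_single_left] using sum_toBilin'_mul_sub hJ v u
    have hd' := congrArg (fun d => contractLeft (Q := (0 : QuadraticForm R _)) d x) hd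
    simp only [map_sum, map_sub, map_smul, LinearMap.sum_apply, LinearMap.sub_apply,
      LinearMap.smul_apply, map_zero, LinearMap.zero_apply] at hd'
    simp only [contractLeft_ι_mul, map_sub, map_smul, toBilin'_single_left]
    have hx' := congrArg (fun y => ι (0 : QuadraticForm R (Fin (2 * r) → R)) v * y) hx
    simp only [Finset.mul_sum, mul_zero] at hx'
    refine Eq.trans (Finset.sum_congr rfl fun i _ => ?_)
      ((Finset.sum_add_distrib).trans ((congrArg₂ (· + ·) hd' hx').trans (add_zero 0)))
    abel

/-- The bivector `e_i ∧ e_ī`. -/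
def bivector (R : Type*) [CommRing R] (r : ℕ) (i : Fin r) :
    ExteriorAlgebra R (Fin (2 * r) → R) :=
  ExteriorAlgebra.ι R (Pi.single (emb r i) 1) * ExteriorAlgebra.ι R (Pi.single (embBar r i) 1)

theorem pfaffian_sum_bivector_mul (hY : IsAltMatrix Y) (hJ : Yᵀ * Jmat r R * Y = 0)
    (htr : ∑ i, Y (emb r i) (embBar r i) = 0) (w : ExteriorAlgebra R (Fin (2 * r) → R)) :
    pfaffian (Matrix.toBilin' Y) hY.isAlt ((∑ i, bivector R r i) * w) = 0 := by
  have h := congrArg (pfaffian (Matrix.toBilin' Y) hY.isAlt) (sum_contractLeft_contractLeft hJ w)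
  rw [map_sum, map_zero] at h
  have h' := congrArg (· * pfaffian (Matrix.toBilin' Y) hY.isAlt w) htr
  simp only [Finset.sum_mul, zero_mul] at h'
  rw [Finset.sum_mul, map_sum]
  refine Eq.trans (Finset.sum_congr rfl fun i _ => ?_)
    ((Finset.sum_sub_distrib _ _).trans ((congrArg₂ (· - ·) h' h).trans (sub_zero 0)))
  rw [bivector, mul_assoc, pfaffian_ι_mul, contractLeft_ι_mul, map_sub, pfaffian_ι_mul]
  simp

theorem sum_pow_card_of_sq_eq_zero {S ι : Type*} [CommRing S] (x : ι → S) (hx : ∀ i, x i ^ 2 = 0)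
    (s : Finset ι) : (∑ i ∈ s, x i) ^ (s.card + 1) = 0 ∧
      (∑ i ∈ s, x i) ^ s.card = (s.card.factorial : S) * ∏ i ∈ s, x i := by
  classical
  induction s using Finset.induction_on with
  | empty => simp
  | insert a s ha ih =>
    have hpow : ∀ n : ℕ, (x a + ∑ i ∈ s, x i) ^ (n + 1) =
        (∑ i ∈ s, x i) ^ (n + 1) + ((n : S) + 1) * x a * (∑ i ∈ s, x i) ^ n := by
      intro n
      induction n with
      | zero => simp; ring
      | succ n ihn =>
        rw [pow_succ, ihn]
        push_cast
        linear_combination (((n : S) + 1) * (∑ i ∈ s, x i) ^ n) * hx a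
    rw [Finset.sum_insert ha, Finset.prod_insert ha, Finset.card_insert_of_notMem ha, hpow, hpow]
    rw [pow_succ _ (s.card + 1), ih.1, ih.2, Nat.factorial_succ]
    push_cast
    constructor <;> ring

theorem bivector_comm (i j : Fin r) : Commute (bivector R r i) (bivector R r j) := by
  have anti : ∀ x y : Fin (2 * r) → R, ExteriorAlgebra.ι R x * ExteriorAlgebra.ι R y =
      -(ExteriorAlgebra.ι R y * ExteriorAlgebra.ι R x) := fun x y =>
    eq_neg_of_add_eq_zero_left (ExteriorAlgebra.ι_add_mul_swap x y)
  have h : ∀ x y z : Fin (2 * r) → R, Commute (ExteriorAlgebra.ι R x * ExteriorAlgebra.ι R y)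
      (ExteriorAlgebra.ι R z) := by
    intro x y z
    rw [Commute, SemiconjBy, mul_assoc, anti y z, mul_neg, ← mul_assoc, anti x z, neg_mul, neg_neg,
      mul_assoc]
  exact (h _ _ _).mul_right (h _ _ _)

theorem bivector_sq (i : Fin r) : bivector R r i ^ 2 = 0 := by
  have h := wedge_eq_zero_of_not_nodup (R := R) (fun a => (Pi.single a 1 : Fin (2 * r) → R))
    (L := [emb r i, embBar r i, emb r i, embBar r i]) (by simp)
  simpa [bivector, pow_two, mul_assoc] using h

/-- The list `i₁, ī₁, i₂, ī₂, …`. -/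
def pairs (r : ℕ) (L : List (Fin r)) : List (Fin (2 * r)) :=
  L.flatMap fun i => [emb r i, embBar r i]

theorem wedge_pairs (L : List (Fin r)) :
    wedge (R := R) (fun a => (Pi.single a 1 : Fin (2 * r) → R)) (pairs r L) =
      (L.map (bivector R r)).prod := by
  induction L with
  | nil => rfl
  | cons i L ih =>
    have : pairs r (i :: L) = emb r i :: embBar r i :: pairs r L := rfl
    rw [this, wedge_cons, wedge_cons, ih, List.map_cons, List.prod_cons, bivector, mul_assoc]

open scoped IsMulCommutative in
theorem factorial_mul_altPf_pairs (hY : IsAltMatrix Y) (hJ : Yᵀ * Jmat r R * Y = 0)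
    (htr : ∑ i, Y (emb r i) (embBar r i) = 0) (Γ : Finset (Fin r)) (L : List (Fin (2 * r))) :
    (Γ.card.factorial : R) * altPf hY (pairs r Γ.toList ++ L) =
      (-1) ^ Γ.card * ∑ f ∈ Fintype.piFinset (fun _ : Fin Γ.card => Γᶜ),
        altPf hY (pairs r (List.ofFn f) ++ L) := by
  let S := Algebra.adjoin R (Set.range (bivector R r))
  have : IsMulCommutative S := Algebra.isMulCommutative_adjoin R (by
    rintro _ ⟨i, rfl⟩ _ ⟨j, rfl⟩
    exact bivector_comm i j)
  let x : Fin r → S := fun i => ⟨bivector R r i, Algebra.subset_adjoin ⟨i, rfl⟩⟩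
  have hx : ∀ i, x i ^ 2 = 0 := fun i => Subtype.ext (bivector_sq i)
  let ψ : S →ₗ[R] R := pfaffian (Matrix.toBilin' Y) hY.isAlt ∘ₗ
    LinearMap.mulRight R (wedge (fun a => Pi.single a 1) L) ∘ₗ S.val.toLinearMap
  have hψ : ∀ l : List (Fin r), ψ (l.map x).prod = altPf hY (pairs r l ++ L) := by
    intro l
    have h1 : S.val (l.map x).prod = (l.map (bivector R r)).prod := by
      rw [map_list_prod, List.map_map]
      rfl
    simp only [ψ, LinearMap.comp_apply, AlgHom.toLinearMap_apply, LinearMap.mulRight_apply]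
    rw [h1, altPf, gramPf, wedge_append, wedge_pairs]
  have hψ0 : ∀ y : S, ψ ((∑ i, x i) * y) = 0 := by
    intro y
    have h := pfaffian_sum_bivector_mul hY hJ htr
      (S.val y * wedge (fun a => Pi.single a 1) L)
    simp only [ψ, LinearMap.comp_apply, AlgHom.toLinearMap_apply, LinearMap.mulRight_apply,
      map_mul, map_sum]
    rw [← h, mul_assoc]
    rfl
  obtain ⟨y, hy⟩ := sub_dvd_pow_sub_pow (∑ i ∈ Γ, x i) (-∑ i ∈ Γᶜ, x i) Γ.card
  rw [sub_neg_eq_add, Finset.sum_add_sum_compl, neg_pow, (sum_pow_card_of_sq_eq_zero x hx Γ).2,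
    Finset.sum_pow'] at hy
  have h := hψ0 y
  rw [← hy, map_sub, sub_eq_zero] at h
  have e1 : ψ ((Γ.card.factorial : S) * ∏ i ∈ Γ, x i) =
      (Γ.card.factorial : R) * altPf hY (pairs r Γ.toList ++ L) := by
    rw [← nsmul_eq_mul, map_nsmul, nsmul_eq_mul, ← Finset.prod_map_toList, hψ]
  have e2 : ∀ z : S, ψ ((-1) ^ Γ.card * z) = (-1) ^ Γ.card * ψ z := by
    intro z
    rcases neg_one_pow_eq_or S Γ.card with h1 | h1 <;>
    rcases Nat.even_or_odd Γ.card with h2 | h2 <;> simp [h2.neg_one_pow]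
  rw [e1, e2, map_sum] at h
  rw [h]
  congr 1
  refine Finset.sum_congr rfl fun f _ => ?_
  rw [← hψ, List.map_ofFn, List.prod_ofFn]
  rfl

end SymplecticRelation

section CoordinateRing

variable (r : ℕ) (F : Type*) [Field F]

/-- The image of the generic matrix in `F[V]`. -/
def Ybar : Matrix (Fin (2 * r)) (Fin (2 * r)) (FV r F) :=
  (Ygen r F).map (Ideal.Quotient.mk (VIdeal r F))

theorem isAltMatrix_Ybar : IsAltMatrix (Ybar r F) := by
  constructor
  · intro i j
    have h : (Ygen r F + (Ygen r F)ᵀ) i j ∈ VIdeal r F :=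
      Ideal.subset_span (Or.inl (Or.inl (Or.inl ⟨i, j, rfl⟩)))
    have h' := Ideal.Quotient.eq_zero_iff_mem.2 h
    rw [Matrix.add_apply, map_add] at h'
    exact eq_neg_of_add_eq_zero_left h'
  · intro i
    have h : Ygen r F i i ∈ VIdeal r F :=
      Ideal.subset_span (Or.inl (Or.inl (Or.inr ⟨i, rfl⟩)))
    exact Ideal.Quotient.eq_zero_iff_mem.2 h

theorem Jmat_map {R R' : Type*} [CommRing R] [CommRing R'] (f : R →+* R') :
    (Jmat r R).map f = Jmat r R' := by
  ext i j
  simp only [Jmat, Matrix.map_apply, Matrix.of_apply]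
  split_ifs <;> simp

theorem Ybar_transpose_mul_Jmat_mul : (Ybar r F)ᵀ * Jmat r (FV r F) * Ybar r F = 0 := by
  rw [Ybar, ← Jmat_map r (Ideal.Quotient.mk (VIdeal r F)), ← Matrix.transpose_map,
    ← Matrix.map_mul, ← Matrix.map_mul]
  ext i j
  exact Ideal.Quotient.eq_zero_iff_mem.2
    (Ideal.subset_span (Or.inl (Or.inr ⟨i, j, rfl⟩)))

theorem trace_Jmat_mul {R : Type*} [CommRing R] {Y : Matrix (Fin (2 * r)) (Fin (2 * r)) R}
    (hY : IsAltMatrix Y) :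
    (Jmat r R * Y).trace = -(2 * ∑ i, Y (emb r i) (embBar r i)) := by
  have h : ∀ x, (Jmat r R * Y).diag x = (Jmat r R *ᵥ fun y => Y y x) x := fun x => rfl
  rw [Matrix.trace, sum_emb_add_sum_embBar]
  simp only [h, Jmat_mulVec_emb, Jmat_mulVec_embBar]
  rw [two_mul, neg_add, Finset.sum_neg_distrib, ← Finset.sum_neg_distrib]
  congr 1
  exact Finset.sum_congr rfl fun i _ => hY.1 _ _

theorem sum_Ybar_emb_embBar (hr : 0 < r) (h2 : (2 : F) ≠ 0) :
    ∑ i, Ybar r F (emb r i) (embBar r i) = 0 := by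
  have hc : (-(Jmat r (FV r F) * Ybar r F)).charpoly = Polynomial.X ^ (2 * r) := by
    have hm : -(Jmat r (FV r F) * Ybar r F) = (-(Jmat r (PolyRing r F) * Ygen r F)).map
        (Ideal.Quotient.mk (VIdeal r F)) := by
      rw [Ybar, ← Jmat_map r (Ideal.Quotient.mk (VIdeal r F)), Matrix.map_neg _ (map_neg _),
        Matrix.map_mul]
    rw [hm, Matrix.charpoly_map]
    ext k
    have h := Ideal.Quotient.eq_zero_iff_mem.2
      (show (Matrix.charpoly (-(Jmat r (PolyRing r F) * Ygen r F)) -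
        Polynomial.X ^ (2 * r)).coeff k ∈ VIdeal r F from Ideal.subset_span (Or.inr ⟨k, rfl⟩))
    rw [Polynomial.coeff_sub, map_sub, sub_eq_zero] at h
    rw [Polynomial.coeff_map, h, ← Polynomial.coeff_map, Polynomial.map_pow, Polynomial.map_X]
  have : Nonempty (Fin (2 * r)) := ⟨⟨0, by omega⟩⟩
  have ht := Matrix.trace_eq_neg_charpoly_coeff (-(Jmat r (FV r F) * Ybar r F))
  rw [hc, Polynomial.coeff_X_pow, if_neg (by simp; omega), Matrix.trace_neg,
    trace_Jmat_mul r (isAltMatrix_Ybar r F), neg_neg, neg_zero] at ht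
  have h2' : IsUnit (2 : FV r F) := by
    rw [← map_ofNat (algebraMap F (FV r F)) 2]
    exact (IsUnit.mk0 _ h2).map _
  exact h2'.mul_right_eq_zero.1 ht

/-- The product of the Pfaffians of the rows of `T` in `F[V]`. -/
def rowProd (T : List (List (Fin (2 * r)))) : FV r F :=
  (T.map (altPf (isAltMatrix_Ybar r F))).prod

variable {r}

theorem tabElem_eq_rowProd {T : List (List (Fin (2 * r)))} (hT : IsEvenTab T) :
    tabElem r F T = rowProd r F T := by
  rw [tabElem, tabPoly, map_list_prod, List.map_map, rowProd]
  congr 1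
  refine List.map_congr_left fun L hL => ?_
  rw [← listPf_eq_altPf (isAltMatrix_Ybar r F) L (hT L hL), Function.comp_apply, listPf, ← pf_map]
  rfl

theorem rowProd_cons (L : List (Fin (2 * r))) (T : List (List (Fin (2 * r)))) :
    rowProd r F (L :: T) = altPf (isAltMatrix_Ybar r F) L * rowProd r F T := by
  simp [rowProd]

theorem rowProd_append (T T' : List (List (Fin (2 * r)))) :
    rowProd r F (T ++ T') = rowProd r F T * rowProd r F T' := by
  simp [rowProd]

theorem rowProd_perm {T T' : List (List (Fin (2 * r)))} (h : T.Perm T') :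
    rowProd r F T = rowProd r F T' :=
  (h.map _).prod_eq

theorem span_rowProd_eq_top :
    Submodule.span F {y | ∃ T : List (List (Fin (2 * r))), IsEvenTab T ∧ rowProd r F T = y} =
      ⊤ := by
  rw [eq_top_iff]
  rintro y -
  obtain ⟨p, rfl⟩ := Ideal.Quotient.mk_surjective y
  induction p using MvPolynomial.induction_on with
  | C c =>
    have h : Ideal.Quotient.mk (VIdeal r F) (MvPolynomial.C c) = c • (1 : FV r F) := by
      rw [← Algebra.algebraMap_eq_smul_one]
      rfl
    rw [h]
    exact Submodule.smul_mem _ _ (Submodule.subset_span ⟨[], by simp [IsEvenTab], rfl⟩)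
  | add p q hp hq =>
    rw [map_add]
    exact Submodule.add_mem _ hp hq
  | mul_X p ij hp =>
    rw [map_mul]
    have hX : Ideal.Quotient.mk (VIdeal r F) (MvPolynomial.X ij) =
        rowProd r F [[ij.1, ij.2]] := by
      simp [rowProd, altPf, gramPf_cons]
      rfl
    rw [hX]
    generalize Ideal.Quotient.mk (VIdeal r F) p = z at hp
    induction hp using Submodule.span_induction with
    | mem z hz =>
      obtain ⟨T, hT, rfl⟩ := hz
      rw [← rowProd_append]
      refine Submodule.subset_span ⟨_, fun L hL => ?_, rfl⟩
      rcases List.mem_append.1 hL with h | h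
      · exact hT L h
      · rw [List.mem_singleton.1 h]
        exact ⟨1, rfl⟩
    | zero => simp
    | add x y _ _ hx hy =>
      rw [add_mul]
      exact Submodule.add_mem _ hx hy
    | smul c x _ hx =>
      rw [smul_mul_assoc]
      exact Submodule.smul_mem _ _ hx

end CoordinateRing

section Straightening

open Polynomial

variable {R α : Type*} [CommRing R]

theorem coe_select {c : ℕ} (C : Fin c → α) (s : Finset (Fin c)) :
    (select C s : Multiset α) = s.val.map C := by
  rw [select, ← Multiset.map_coe]
  congr 1
  refine (Multiset.Nodup.ext (Multiset.coe_nodup.2 ((List.nodup_finRange c).filter _)) s.nodup).2 fun i => ?_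
  simp

theorem select_append_select_compl {c : ℕ} (C : Fin c → α) (s : Finset (Fin c)) :
    (select C s ++ select C sᶜ).Perm (List.ofFn C) := by
  rw [← Multiset.coe_eq_coe, ← Multiset.coe_add, coe_select, coe_select, ← Multiset.map_add,
    ← Finset.disjUnion_val s sᶜ disjoint_compl_right, Finset.disjUnion_eq_union,
    Finset.union_compl, List.ofFn_eq_map, ← Multiset.map_coe]
  rfl

theorem sum_lt_sum_of_threshold {ι : Type*} [DecidableEq ι] (w : ι → ℕ) (m : ℕ)
    {s s₀ : Finset ι} (h₀ : ∀ i ∈ s₀, m ≤ w i) (h : ∀ i ∉ s₀, w i < m) (hc : s.card = s₀.card)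
    (hs : s ≠ s₀) : ∑ i ∈ s, w i < ∑ i ∈ s₀, w i := by
  have hne : (s \ s₀).Nonempty := by
    rw [Finset.sdiff_nonempty]
    exact fun hsub => hs (Finset.eq_of_subset_of_card_le hsub hc.ge)
  have hcard : (s \ s₀).card = (s₀ \ s).card := Finset.card_sdiff_comm hc
  rw [← Finset.sum_inter_add_sum_sdiff s s₀, ← Finset.sum_inter_add_sum_sdiff s₀ s,
    Finset.inter_comm s₀ s]
  refine Nat.add_lt_add_left ?_ _
  calc ∑ i ∈ s \ s₀, w i < ∑ i ∈ s \ s₀, m :=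
        Finset.sum_lt_sum_of_nonempty hne fun i hi => h i (Finset.mem_sdiff.1 hi).2
    _ = ∑ i ∈ s₀ \ s, m := by rw [Finset.sum_const, Finset.sum_const, hcard]
    _ ≤ ∑ i ∈ s₀ \ s, w i := Finset.sum_le_sum fun i hi => h₀ i (Finset.mem_sdiff.1 hi).1

variable [Fintype α] [DecidableEq α]

theorem altPf_mem_of_perm {A : Matrix α α R} (hA : IsAltMatrix A) (K : AddSubgroup R)
    {L L' : List α} (h : L.Perm L') (z : R) (hL : altPf hA L * z ∈ K) : altPf hA L' * z ∈ K := by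
  rcases gramPf_perm (Matrix.toBilin' A) hA.isAlt (fun a => Pi.single a 1) h with h | h
  · rwa [altPf, ← h]
  · rw [altPf, ← neg_eq_iff_eq_neg.2 h, neg_mul]
    exact K.neg_mem hL

/-- Straightening of a violation of standardness in column `t` of two adjacent rows. -/
theorem altPf_mul_altPf_mem {Y : Matrix α α R} (hY : IsAltMatrix Y) (w : α → ℕ)
    (K : AddSubgroup R) (A B : List α) (hA : Even A.length) (hB : Even B.length)
    (hAB : B.length ≤ A.length) (hA' : A.Pairwise fun x y => w x < w y)
    (hB' : B.Pairwise fun x y => w x < w y) (t : ℕ) (ht : t < B.length)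
    (hviol : w B[t] < w (A[t]'(ht.trans_le hAB)))
    (hK : ∀ A' B' : List α, (A' ++ B').Perm (A ++ B) → Even A'.length → Even B'.length →
      (A.length ^ 2 + B.length ^ 2 < A'.length ^ 2 + B'.length ^ 2 ∨
        A'.length = A.length ∧ B'.length = B.length ∧ (A'.map w).sum < (A.map w).sum) →
      altPf hY A' * altPf hY B' ∈ K) :
    altPf hY A * altPf hY B ∈ K := by
  obtain ⟨k, hk⟩ := even_iff_exists_two_mul.1 hA
  obtain ⟨l, hl⟩ := even_iff_exists_two_mul.1 hB
  set b := B.take (t + 1) with hb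
  set a := A.drop t with ha
  have hbl : b.length = t + 1 := by simp [hb]; omega
  have hal : a.length = 2 * k - t := by simp [ha]; omega
  let C : Fin (b.length + a.length) → α := Fin.append b.get a.get
  have hC : List.ofFn C = b ++ a := by
    rw [List.ofFn_fin_append, List.ofFn_get, List.ofFn_get]
  let s₀ : Finset (Fin (b.length + a.length)) := Finset.univ.map (Fin.natAddEmb b.length)
  have hs₀ : s₀.card = a.length := by simp [s₀]
  have hsel : (select C s₀).Perm a := by
    rw [← Multiset.coe_eq_coe, coe_select, Finset.map_val, Multiset.map_map]
    have : (C ∘ Fin.natAddEmb b.length) = a.get := by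
      ext i
      simp [C]
    rw [this]
    conv_rhs => rw [← List.ofFn_get a, List.ofFn_eq_map, ← Multiset.map_coe]
    rfl
  have hselc : (select C s₀ᶜ).Perm b := by
    have h := select_append_select_compl C s₀
    rw [hC] at h
    exact (List.perm_append_left_iff a).1
      (((hsel.symm.append_right _).trans h).trans List.perm_append_comm)
  have hw₀ : ∀ i ∈ s₀, w (A[t]'(ht.trans_le hAB)) ≤ w (C i) := by
    intro i hi
    obtain ⟨j, -, rfl⟩ := Finset.mem_map.1 hi
    simp only [C, Fin.natAddEmb_apply, Fin.append_right, ha, List.get_eq_getElem,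
      List.getElem_drop]
    rcases Nat.eq_zero_or_pos (j : ℕ) with h | h
    · simp [h]
    · exact (List.pairwise_iff_getElem.1 hA' _ _ _ _ (by omega)).le
  have hw : ∀ i ∉ s₀, w (C i) < w (A[t]'(ht.trans_le hAB)) := by
    intro i
    induction i using Fin.addCases with
    | left j =>
      intro _
      refine lt_of_le_of_lt ?_ hviol
      simp only [C, Fin.append_left, hb, List.get_eq_getElem, List.getElem_take]
      have hj := j.isLt
      rcases Nat.lt_or_ge (j : ℕ) t with h | h
      · exact (List.pairwise_iff_getElem.1 hB' _ _ _ _ h).le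
      · have : (j : ℕ) = t := by omega
        simp [this]
    | right j =>
      intro h
      exact absurd (Finset.mem_map.2 ⟨j, Finset.mem_univ _, rfl⟩) h
  obtain ⟨G, ε, hε, hG, hcoeff⟩ :=
    exists_shuffle_polynomial hY (A.take t) (B.drop (t + 1)) C
  have hperm : ∀ s, ((A.take t ++ select C s) ++ (select C sᶜ ++ B.drop (t + 1))).Perm
      (A ++ B) := by
    intro s
    have h : ((A.take t ++ select C s) ++ (select C sᶜ ++ B.drop (t + 1))).Perm
        (A.take t ++ ((b ++ a) ++ B.drop (t + 1))) := by
      rw [← hC, List.append_assoc, ← List.append_assoc (select C s)]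
      exact ((select_append_select_compl C s).append_right _).append_left _
    refine h.trans ?_
    conv_rhs => rw [← List.take_append_drop t A, ← List.take_append_drop (t + 1) B]
    rw [List.append_assoc (A.take t)]
    refine List.Perm.append_left _ ?_
    rw [← List.append_assoc a]
    exact List.perm_append_comm.append_right _
  have hlen : ∀ s, (A.take t ++ select C s).length = t + s.card := by
    intro s
    rw [List.length_append, length_select, List.length_take]
    omega
  have hlen' : ∀ s, (select C sᶜ ++ B.drop (t + 1)).length + (t + s.card) = 2 * k + 2 * l := by
    intro s
    have := (hperm s).length_eq
    rw [List.length_append, hlen, List.length_append (as := A)] at this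
    omega
  have hmul : ∀ s, ∀ z ∈ K, ε s * z ∈ K := by
    intro s z hz
    rcases hε s with h | h <;> simpa [h] using hz
  have hwin := coeff_mem_of_window K (k - l + 1) (2 * k - t) G
    (hG _ (by simp; omega)) (fun j hj => by
      rw [hcoeff]
      refine sum_mem fun s hs => hmul s _ ?_
      have hsj : s.card = j := (Finset.mem_filter.1 hs).2
      rcases Nat.even_or_odd (t + j) with he | ho
      · refine hK _ _ (hperm s) (by rwa [hlen, hsj]) ?_ (Or.inl ?_)
        · have h1 := hlen' s
          rw [hsj] at h1
          obtain ⟨u, hu⟩ := he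
          exact ⟨k + l - u, by omega⟩
        · have h1 := hlen' s
          rw [hlen]
          rw [hsj] at h1 ⊢
          rw [hk, hl]
          obtain ⟨u, hu⟩ := he
          have hout : 2 * k < t + j ∨ t + j < 2 * l := by
            by_contra! hcon
            exact hj ⟨k - u, by omega, by omega⟩
          zify at h1 hout ⊢
          rcases hout with hout | hout <;> nlinarith
      · have h0 : altPf hY (A.take t ++ select C s) = 0 :=
          gramPf_of_odd _ _ _ _ (by rwa [hlen, hsj])
        rw [h0, zero_mul]
        exact K.zero_mem) (2 * k - t)
  rw [hcoeff, ← Finset.add_sum_erase _ _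
    (Finset.mem_filter.2 ⟨Finset.mem_univ s₀, hs₀.trans hal⟩)] at hwin
  have hrest := (K.add_mem_cancel_right (sum_mem fun s hs => hmul s _ ?_)).1 hwin
  · have h1 : altPf hY (A.take t ++ select C s₀) *
        altPf hY (select C s₀ᶜ ++ B.drop (t + 1)) ∈ K := by
      have := hmul s₀ _ hrest
      rcases hε s₀ with h | h <;> simpa [h] using this
    have h2 := altPf_mem_of_perm hY K (hsel.append_left _) _ h1
    rw [mul_comm] at h2
    have h3 := altPf_mem_of_perm hY K (hselc.append_right _) _ h2
    rwa [mul_comm, List.take_append_drop, List.take_append_drop] at h3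
  · obtain ⟨hne, hs⟩ := Finset.mem_erase.1 hs
    have hsj : s.card = 2 * k - t := (Finset.mem_filter.1 hs).2
    have h1 := hlen' s
    refine hK _ _ (hperm s) ⟨k, by rw [hlen]; omega⟩ ⟨l, by omega⟩
      (Or.inr ⟨by rw [hlen]; omega, by omega, ?_⟩)
    have h4 : ∀ s, ((select C s).map w).sum = ∑ i ∈ s, w (C i) := by
      intro s
      rw [← Multiset.sum_coe, ← Multiset.map_coe, coe_select, Multiset.map_map]
      rfl
    conv_rhs => rw [← List.take_append_drop t A]
    rw [List.map_append, List.map_append, List.sum_append, List.sum_append, h4,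
      ← ((hsel.map w).sum_eq), h4]
    exact Nat.add_lt_add_left (sum_lt_sum_of_threshold (fun i => w (C i)) _ hw₀ hw
      (by omega) hne) _

end Straightening

section SymplecticStep

variable {r : ℕ}

/-- The index `i` of the entries `i` and `ī`. -/
def pairIdx (x : Fin (2 * r)) : Fin r :=
  if h : x.val < r then ⟨x, h⟩ else ⟨x - r, by omega⟩

@[simp] theorem pairIdx_emb (i : Fin r) : pairIdx (emb r i) = i := by
  simp [pairIdx, emb]

@[simp] theorem pairIdx_embBar (i : Fin r) : pairIdx (embBar r i) = i := by
  simp [pairIdx, embBar]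

theorem eq_emb_or_eq_embBar (x : Fin (2 * r)) :
    x = emb r (pairIdx x) ∨ x = embBar r (pairIdx x) := by
  by_cases h : x.val < r
  · exact Or.inl (Fin.ext (by simp [pairIdx, emb, h]))
  · exact Or.inr (Fin.ext (by simp [pairIdx, embBar, h]; omega))

theorem emb_ne_embBar (i j : Fin r) : emb r i ≠ embBar r j := by
  intro h
  have := congrArg Fin.val h
  simp only [emb, embBar] at this
  omega

theorem pairIdx_eq_iff (x : Fin (2 * r)) (i : Fin r) :
    pairIdx x = i ↔ x = emb r i ∨ x = embBar r i := by
  constructor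
  · rintro rfl
    exact eq_emb_or_eq_embBar x
  · rintro (rfl | rfl) <;> simp

theorem pairIdx_le_of_ordIdx_le {x y : Fin (2 * r)} (h : ordIdx r x ≤ ordIdx r y) :
    pairIdx x ≤ pairIdx y := by
  rw [Fin.le_def]
  unfold ordIdx at h
  unfold pairIdx
  split_ifs at h ⊢ <;> simp <;> omega

/-- A weight of rows which the symplectic relation increases. -/
def rowWeight (L : List (Fin (2 * r))) : ℕ :=
  (L.map fun x : Fin (2 * r) => (r + 1) ^ (pairIdx x : ℕ)).sum

theorem rowWeight_append (L L' : List (Fin (2 * r))) :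
    rowWeight (L ++ L') = rowWeight L + rowWeight L' := by
  simp [rowWeight]

theorem rowWeight_perm {L L' : List (Fin (2 * r))} (h : L.Perm L') :
    rowWeight L = rowWeight L' :=
  (h.map _).sum_eq

theorem rowWeight_le (L : List (Fin (2 * r))) : rowWeight L ≤ L.length * (r + 1) ^ r := by
  have h := List.sum_le_card_nsmul (L.map fun x : Fin (2 * r) => (r + 1) ^ (pairIdx x : ℕ)) ((r + 1) ^ r)
    (by
      intro y hy
      obtain ⟨x, -, rfl⟩ := List.mem_map.1 hy
      exact Nat.pow_le_pow_right (by omega) (pairIdx x).isLt.le)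
  simpa [rowWeight] using h

theorem rowWeight_pairs (l : List (Fin r)) :
    rowWeight (pairs r l) = (l.map fun i : Fin r => 2 * (r + 1) ^ (i : ℕ)).sum := by
  induction l with
  | nil => rfl
  | cons i l ih =>
    have : pairs r (i :: l) = [emb r i, embBar r i] ++ pairs r l := rfl
    rw [this, rowWeight_append, ih]
    simp [rowWeight, two_mul]

theorem mem_pairs {l : List (Fin r)} {x : Fin (2 * r)} : x ∈ pairs r l ↔ pairIdx x ∈ l := by
  simp only [pairs, List.mem_flatMap, List.mem_cons, List.not_mem_nil, or_false, ← pairIdx_eq_iff]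
  simp

theorem nodup_pairs {l : List (Fin r)} (h : l.Nodup) : (pairs r l).Nodup := by
  rw [pairs, List.nodup_flatMap]
  refine ⟨fun i _ => by simp [emb_ne_embBar], h.imp fun {i j} hij => ?_⟩
  rw [Function.onFun, List.disjoint_left]
  intro x hx hx'
  simp only [List.mem_cons, List.not_mem_nil, or_false, ← pairIdx_eq_iff] at hx hx'
  exact hij (hx.symm.trans hx')

theorem length_pairs (l : List (Fin r)) : (pairs r l).length = 2 * l.length := by
  induction l with
  | nil => rfl
  | cons i l ih =>
    have : pairs r (i :: l) = [emb r i, embBar r i] ++ pairs r l := rfl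
    rw [this, List.length_append, ih, List.length_cons]
    simp
    omega

theorem nodup_of_nodup_pairs {l : List (Fin r)} (h : (pairs r l).Nodup) : l.Nodup := by
  have h1 : ((pairs r l).filter fun x => x.val < r) = l.map (emb r) := by
    clear h
    induction l with
    | nil => rfl
    | cons i l ih =>
      have : pairs r (i :: l) = [emb r i, embBar r i] ++ pairs r l := rfl
      rw [this, List.filter_append, ih]
      simp [emb, embBar]
  exact List.Nodup.of_map (emb r) (h1 ▸ h.filter _)

theorem perm_pairs_append_filter {L : List (Fin (2 * r))} (hL : L.Nodup) (Γ : Finset (Fin r))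
    (hΓ : ∀ i ∈ Γ, emb r i ∈ L ∧ embBar r i ∈ L) :
    L.Perm (pairs r Γ.toList ++ L.filter fun x => pairIdx x ∉ Γ) := by
  have h := List.filter_append_perm (fun x => decide (pairIdx x ∈ Γ)) L
  refine h.symm.trans ?_
  have h2 : (L.filter fun x => !decide (pairIdx x ∈ Γ)) = L.filter fun x => pairIdx x ∉ Γ := by
    simp
  rw [h2]
  refine List.Perm.append_right _ ?_
  rw [List.perm_ext_iff_of_nodup (hL.filter _) (nodup_pairs Γ.nodup_toList)]
  intro x
  rw [mem_pairs, Finset.mem_toList, List.mem_filter, decide_eq_true_iff]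
  refine ⟨fun h => h.2, fun h => ⟨?_, h⟩⟩
  obtain ⟨h1, h2⟩ := hΓ _ h
  rcases eq_emb_or_eq_embBar x with hx | hx <;> rw [hx] <;> assumption

/-- Rows with too many small entries contain more full pairs than empty pairs. -/
theorem card_empty_lt_card_full {L : List (Fin (2 * r))} (p : Fin r) (S : Finset (Fin (2 * r)))
    (hS : ∀ x ∈ S, x ∈ L ∧ pairIdx x ≤ p) (hc : (p : ℕ) + 2 ≤ S.card) :
    ((Finset.Iic p).filter fun i => emb r i ∉ L ∧ embBar r i ∉ L).card <
      ((Finset.Iic p).filter fun i => emb r i ∈ L ∧ embBar r i ∈ L).card := by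
  have h1 : S.card = ∑ i ∈ Finset.Iic p, (S.filter fun x => pairIdx x = i).card :=
    Finset.card_eq_sum_card_fiberwise fun x hx => Finset.mem_coe.2 (Finset.mem_Iic.2 (hS x hx).2)
  rw [Finset.card_filter, Finset.card_filter]
  have h2 : ∀ i : Fin r, (S.filter fun x => pairIdx x = i).card +
      (if emb r i ∉ L ∧ embBar r i ∉ L then 1 else 0) ≤
      1 + if emb r i ∈ L ∧ embBar r i ∈ L then 1 else 0 := by
    intro i
    have hsub : (S.filter fun x => pairIdx x = i) ⊆
        ({emb r i, embBar r i} : Finset _).filter (· ∈ L) := by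
      intro x hx
      obtain ⟨hx1, hx2⟩ := Finset.mem_filter.1 hx
      rw [pairIdx_eq_iff] at hx2
      simp [(hS x hx1).1, hx2]
    refine (Nat.add_le_add_right (Finset.card_le_card hsub) _).trans ?_
    rw [Finset.filter_insert, Finset.filter_singleton]
    by_cases ha : emb r i ∈ L <;> by_cases hb : embBar r i ∈ L <;>
      simp [ha, hb, Finset.card_pair (emb_ne_embBar i i)]
  have h3 := Finset.sum_le_sum fun i (_ : i ∈ Finset.Iic p) => h2 i
  rw [Finset.sum_add_distrib, Finset.sum_add_distrib, ← h1] at h3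
  simp only [Finset.sum_const, Fin.card_Iic, smul_eq_mul, mul_one] at h3
  omega

/-- Rewriting a row that violates the symplectic condition in column `t`. -/
theorem altPf_mem_of_not_symplectic {F R : Type*} [Field F] [CommRing R] [Algebra F R]
    (hF : ∀ a ≤ r, (a.factorial : F) ≠ 0)
    {Y : Matrix (Fin (2 * r)) (Fin (2 * r)) R} (hY : IsAltMatrix Y)
    (hJ : Yᵀ * Jmat r R * Y = 0) (htr : ∑ i, Y (emb r i) (embBar r i) = 0)
    (K : Submodule F R) (L : List (Fin (2 * r)))
    (hL : L.Pairwise fun x y => ordIdx r x < ordIdx r y) (t : ℕ) (ht : t < L.length)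
    (hviol : (pairIdx L[t] : ℕ) < t)
    (hK : ∀ L' : List (Fin (2 * r)), L'.length = L.length → rowWeight L < rowWeight L' →
      altPf hY L' ∈ K) :
    altPf hY L ∈ K := by
  set p := pairIdx L[t] with hp
  have hnd : L.Nodup := hL.imp fun h => by rintro rfl; exact lt_irrefl _ h
  let E := (Finset.Iic p).filter fun i => emb r i ∉ L ∧ embBar r i ∉ L
  let Γ := (Finset.Iic p).filter fun i => emb r i ∈ L ∧ embBar r i ∈ L
  have hEΓ : E.card < Γ.card := by
    refine card_empty_lt_card_full p (L.take (t + 1)).toFinset ?_ ?_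
    · intro x hx
      rw [List.mem_toFinset] at hx
      refine ⟨List.mem_of_mem_take hx, ?_⟩
      obtain ⟨i, hi, rfl⟩ := List.mem_iff_getElem.1 hx
      rw [List.getElem_take]
      rw [List.length_take] at hi
      refine pairIdx_le_of_ordIdx_le ?_
      rcases Nat.lt_or_ge i t with h | h
      · exact (List.pairwise_iff_getElem.1 hL _ _ _ _ h).le
      · have : i = t := by omega
        simp [this]
    · rw [List.toFinset_card_of_nodup (hnd.sublist (List.take_sublist _ _)), List.length_take]
      omega
  have hΓr : Γ.card ≤ r := (Finset.card_le_univ _).trans (by simp)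
  set rest := L.filter fun x => pairIdx x ∉ Γ with hrest
  have hperm : L.Perm (pairs r Γ.toList ++ rest) :=
    perm_pairs_append_filter hnd Γ fun i hi => (Finset.mem_filter.1 hi).2
  have hmem : ∀ f ∈ Fintype.piFinset (fun _ : Fin Γ.card => Γᶜ),
      altPf hY (pairs r (List.ofFn f) ++ rest) ∈ K := by
    intro f hf
    by_cases hn : (pairs r (List.ofFn f) ++ rest).Nodup
    swap
    · rw [altPf, gramPf_eq_zero_of_not_nodup _ _ _ hn]
      exact K.zero_mem
    obtain ⟨hn1, -, hn3⟩ := List.nodup_append'.1 hn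
    have hfinj : Function.Injective f := List.nodup_ofFn.1 (nodup_of_nodup_pairs hn1)
    have hfΓ : ∀ i, f i ∉ Γ := fun i => Finset.mem_compl.1 (Fintype.mem_piFinset.1 hf i)
    have hex : ∃ i, p < f i := by
      by_contra! hcon
      have hsub : Finset.univ.map ⟨f, hfinj⟩ ⊆ E := by
        intro x hx
        obtain ⟨i, -, rfl⟩ := Finset.mem_map.1 hx
        have hnot : ∀ y, pairIdx y = f i → y ∉ L := by
          intro y hy hyL
          refine hn3 (mem_pairs.2 ?_) (List.mem_filter.2 ⟨hyL, ?_⟩)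
          · rw [hy, List.mem_ofFn]
            exact ⟨i, rfl⟩
          · simpa [hy] using hfΓ i
        exact Finset.mem_filter.2 ⟨Finset.mem_Iic.2 (hcon i), hnot _ (pairIdx_emb _),
          hnot _ (pairIdx_embBar _)⟩
      have := Finset.card_le_card hsub
      rw [Finset.card_map, Finset.card_univ, Fintype.card_fin] at this
      omega
    refine hK _ ?_ ?_
    · rw [hperm.length_eq, List.length_append, List.length_append, length_pairs, length_pairs]
      simp
    · rw [rowWeight_perm hperm, rowWeight_append, rowWeight_append]
      refine Nat.add_lt_add_right ?_ _
      obtain ⟨i, hi⟩ := hex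
      have h1 : rowWeight (pairs r Γ.toList) ≤ Γ.card * (2 * (r + 1) ^ (p : ℕ)) := by
        rw [rowWeight_pairs]
        have h := List.sum_le_card_nsmul (Γ.toList.map fun i : Fin r => 2 * (r + 1) ^ (i : ℕ))
          (2 * (r + 1) ^ (p : ℕ)) (by
            intro y hy
            obtain ⟨x, hx, rfl⟩ := List.mem_map.1 hy
            have hxp : x ≤ p :=
              Finset.mem_Iic.1 (Finset.mem_filter.1 (Finset.mem_toList.1 hx)).1
            exact Nat.mul_le_mul_left _ (Nat.pow_le_pow_right (by omega) hxp))
        simpa using h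
      have h2 : 2 * (r + 1) ^ (f i : ℕ) ≤ rowWeight (pairs r (List.ofFn f)) := by
        rw [rowWeight_pairs]
        exact List.single_le_sum (by simp) _ (List.mem_map.2 ⟨f i, by simp, rfl⟩)
      have h3 : (r + 1) ^ ((p : ℕ) + 1) ≤ (r + 1) ^ (f i : ℕ) :=
        Nat.pow_le_pow_right (by omega) hi
      have h4 : Γ.card * (2 * (r + 1) ^ (p : ℕ)) ≤ r * (2 * (r + 1) ^ (p : ℕ)) :=
        Nat.mul_le_mul_right _ hΓr
      have h5 : 0 < (r + 1) ^ (p : ℕ) := by positivity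
      rw [pow_succ] at h3
      nlinarith
  have hneg : ∀ y ∈ K, (-1 : R) ^ Γ.card * y ∈ K := by
    intro y hy
    rcases neg_one_pow_eq_or R Γ.card with h | h <;> simpa [h] using hy
  have hfact := hneg _ (K.sum_mem hmem)
  rw [← factorial_mul_altPf_pairs hY hJ htr Γ rest] at hfact
  have hunit : (Γ.card.factorial : R) = algebraMap F R (Γ.card.factorial : F) := by simp
  rw [hunit, ← Algebra.smul_def, K.smul_mem_iff (hF _ hΓr)] at hfact
  have := altPf_mem_of_perm hY K.toAddSubgroup hperm.symm 1 (by simpa using hfact)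
  simpa using this

end SymplecticStep

section Induction

variable {r : ℕ}

theorem ordIdx_injective : Function.Injective (ordIdx r) := by
  intro x y h
  unfold ordIdx at h
  apply Fin.ext
  split_ifs at h <;> omega

/-- The total number of entries of a tableau. -/
def tabSize {α : Type*} (T : List (List α)) : ℕ := (T.map List.length).sum

/-- The sum of the squares of the row lengths of a tableau. -/
def tabSq {α : Type*} (T : List (List α)) : ℕ := (T.map fun L => L.length ^ 2).sum

/-- The total weight of the rows of a tableau. -/
def tabWeight (T : List (List (Fin (2 * r)))) : ℕ := (T.map rowWeight).sum

/-- The row sums of a tableau, with larger multiplicities for higher rows. -/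
def leadSum : List (List (Fin (2 * r))) → ℕ
  | [] => 0
  | L :: T => leadSum T + (T.length + 1) * (L.map (ordIdx r)).sum

theorem tabWeight_le (T : List (List (Fin (2 * r)))) :
    tabWeight T ≤ tabSize T * (r + 1) ^ r := by
  rw [tabWeight, tabSize, ← List.sum_map_mul_right]
  exact List.sum_le_sum fun L _ => rowWeight_le L

theorem tabSq_le {α : Type*} (T : List (List α)) : tabSq T ≤ tabSize T ^ 2 := by
  induction T with
  | nil => simp [tabSq]
  | cons L T ih =>
    simp only [tabSq, tabSize, List.map_cons, List.sum_cons] at ih ⊢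
    nlinarith [Nat.zero_le (L.length * (T.map List.length).sum)]

theorem leadSum_append_lt (P : List (List (Fin (2 * r)))) {X X' : List (List (Fin (2 * r)))}
    (hlen : X.length = X'.length) (h : leadSum X < leadSum X') :
    leadSum (P ++ X) < leadSum (P ++ X') := by
  induction P with
  | nil => exact h
  | cons L P ih =>
    simp only [List.cons_append, leadSum, List.length_append, hlen]
    omega

theorem leadSum_map (g : List (Fin (2 * r)) → List (Fin (2 * r))) (hg : ∀ L, (g L).Perm L)
    (T : List (List (Fin (2 * r)))) : leadSum (T.map g) = leadSum T := by
  induction T with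
  | nil => rfl
  | cons L T ih =>
    simp only [List.map_cons, leadSum, ih, List.length_map, ((hg L).map (ordIdx r)).sum_eq]

theorem sum_map_filter_ne_nil {α : Type*} (f : List α → ℕ) (hf : f [] = 0)
    (T : List (List α)) : ((T.filter fun L => !L.isEmpty).map f).sum = (T.map f).sum := by
  induction T with
  | nil => rfl
  | cons L T ih => cases L <;> simp [hf, ih]

variable {F : Type*} [Field F]

theorem rowProd_filter_ne_nil (T : List (List (Fin (2 * r)))) :
    rowProd r F (T.filter fun L => !L.isEmpty) = rowProd r F T := by
  induction T with
  | nil => rfl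
  | cons L T ih => cases L <;> simp [rowProd_cons, ih, altPf]

theorem rowProd_map (g : List (Fin (2 * r)) → List (Fin (2 * r))) (hg : ∀ L, (g L).Perm L)
    (T : List (List (Fin (2 * r)))) :
    rowProd r F (T.map g) = rowProd r F T ∨ rowProd r F (T.map g) = -rowProd r F T := by
  induction T with
  | nil => exact Or.inl rfl
  | cons L T ih =>
    have h1 : altPf (isAltMatrix_Ybar r F) (g L) = altPf (isAltMatrix_Ybar r F) L ∨
        altPf (isAltMatrix_Ybar r F) (g L) = -altPf (isAltMatrix_Ybar r F) L :=
      gramPf_perm _ _ _ (hg L)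
    rw [List.map_cons, rowProd_cons, rowProd_cons]
    rcases h1 with h1 | h1 <;> rcases ih with h2 | h2 <;> rw [h1, h2]
    · exact Or.inl rfl
    · exact Or.inr (by ring)
    · exact Or.inr (by ring)
    · exact Or.inl (by ring)

theorem rowProd_eq_zero {T : List (List (Fin (2 * r)))} {L : List (Fin (2 * r))} (hL : L ∈ T)
    (hn : ¬ L.Nodup) : rowProd r F T = 0 :=
  List.prod_eq_zero (List.mem_map.2 ⟨L, hL, gramPf_eq_zero_of_not_nodup _ _ _ hn⟩)

theorem rowProd_mem_of_not_symplectic (hr : 0 < r) (hF : ∀ a ≤ r, (a.factorial : F) ≠ 0)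
    (h2 : (2 : F) ≠ 0) (Sp : Submodule F (FV r F)) (P Q : List (List (Fin (2 * r))))
    (L : List (Fin (2 * r))) (hE : IsEvenTab (P ++ L :: Q))
    (hL : L.Pairwise fun x y => ordIdx r x < ordIdx r y) (t : ℕ) (ht : t < L.length)
    (hviol : (pairIdx L[t] : ℕ) < t)
    (ih : ∀ T', IsEvenTab T' → tabSize T' = tabSize (P ++ L :: Q) →
      tabWeight (P ++ L :: Q) < tabWeight T' → rowProd r F T' ∈ Sp) :
    rowProd r F (P ++ L :: Q) ∈ Sp := by
  have hsplit : ∀ L', rowProd r F (P ++ L' :: Q) =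
      altPf (isAltMatrix_Ybar r F) L' * (rowProd r F P * rowProd r F Q) := by
    intro L'
    rw [rowProd_append, rowProd_cons]
    ring
  rw [hsplit]
  refine altPf_mem_of_not_symplectic hF (isAltMatrix_Ybar r F)
    (Ybar_transpose_mul_Jmat_mul r F) (sum_Ybar_emb_embBar r F hr h2)
    (Sp.comap (LinearMap.mulRight F (rowProd r F P * rowProd r F Q))) L hL t ht hviol
    fun L' hlen hw => ?_
  rw [Submodule.mem_comap, LinearMap.mulRight_apply, ← hsplit]
  refine ih _ (fun M hM => ?_) (by simp [tabSize, hlen]) (by simpa [tabWeight] using hw)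
  simp only [IsEvenTab, List.mem_append, List.mem_cons] at hE hM
  rcases hM with h | rfl | h
  · exact hE M (Or.inl h)
  · rw [hlen]
    exact hE L (Or.inr (Or.inl rfl))
  · exact hE M (Or.inr (Or.inr h))

theorem rowProd_mem_of_not_standard (Sp : Submodule F (FV r F)) (P Q : List (List (Fin (2 * r))))
    (A B : List (Fin (2 * r))) (hE : IsEvenTab (P ++ A :: B :: Q)) (hAB : B.length ≤ A.length)
    (hA : A.Pairwise fun x y => ordIdx r x < ordIdx r y)
    (hB : B.Pairwise fun x y => ordIdx r x < ordIdx r y) (t : ℕ) (ht : t < B.length)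
    (hviol : ordIdx r B[t] < ordIdx r (A[t]'(ht.trans_le hAB)))
    (ih : ∀ T', IsEvenTab T' → tabSize T' = tabSize (P ++ A :: B :: Q) →
      tabWeight T' = tabWeight (P ++ A :: B :: Q) →
      (tabSq (P ++ A :: B :: Q) < tabSq T' ∨
        T'.map List.length = (P ++ A :: B :: Q).map List.length ∧
        leadSum T' < leadSum (P ++ A :: B :: Q)) → rowProd r F T' ∈ Sp) :
    rowProd r F (P ++ A :: B :: Q) ∈ Sp := by
  have hsplit : ∀ A' B', rowProd r F (P ++ A' :: B' :: Q) =
      (altPf (isAltMatrix_Ybar r F) A' * altPf (isAltMatrix_Ybar r F) B') *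
        (rowProd r F P * rowProd r F Q) := by
    intro A' B'
    rw [rowProd_append, rowProd_cons, rowProd_cons]
    ring
  rw [hsplit]
  simp only [IsEvenTab, List.mem_append, List.mem_cons] at hE
  refine altPf_mul_altPf_mem (isAltMatrix_Ybar r F) (ordIdx r)
    (Sp.comap (LinearMap.mulRight F (rowProd r F P * rowProd r F Q))).toAddSubgroup A B
    (hE A (by simp)) (hE B (by simp)) hAB hA hB t ht hviol fun A' B' hperm hA' hB' h => ?_
  rw [Submodule.mem_toAddSubgroup, Submodule.mem_comap, LinearMap.mulRight_apply, ← hsplit]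
  have hlen := hperm.length_eq
  have hwt := rowWeight_perm hperm
  have hsum := (hperm.map (ordIdx r)).sum_eq
  rw [List.map_append, List.map_append, List.sum_append, List.sum_append] at hsum
  rw [List.length_append, List.length_append] at hlen
  rw [rowWeight_append, rowWeight_append] at hwt
  refine ih _ (fun M hM => ?_) ?_ ?_ ?_
  · simp only [List.mem_append, List.mem_cons] at hM
    rcases hM with h | rfl | rfl | h
    · exact hE M (Or.inl h)
    · exact hA'
    · exact hB'
    · exact hE M (Or.inr (Or.inr (Or.inr h)))
  · simp only [tabSize, List.map_append, List.map_cons, List.sum_append, List.sum_cons]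
    omega
  · simp only [tabWeight, List.map_append, List.map_cons, List.sum_append, List.sum_cons]
    omega
  · refine h.imp (fun h => ?_) fun ⟨h1, h3, h4⟩ => ⟨by simp [h1, h3], ?_⟩
    · simp only [tabSq, List.map_append, List.map_cons, List.sum_append, List.sum_cons]
      omega
    · refine leadSum_append_lt P (by simp) ?_
      simp only [leadSum, List.length_cons]
      nlinarith

theorem rowProd_mem_of_isShape (hr : 0 < r) (hF : ∀ a ≤ r, (a.factorial : F) ≠ 0)
    (h2 : (2 : F) ≠ 0) (Sp : Submodule F (FV r F))
    (hSp : ∀ T, IsSSET r T → rowProd r F T ∈ Sp) (T : List (List (Fin (2 * r))))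
    (hE : IsEvenTab T) (hS : IsShape T)
    (ih : ∀ T', IsEvenTab T' → tabSize T' = tabSize T → (tabWeight T < tabWeight T' ∨
      tabWeight T' = tabWeight T ∧ tabSq T < tabSq T') → rowProd r F T' ∈ Sp) :
    rowProd r F T ∈ Sp := by
  induction hs : leadSum T using Nat.strong_induction_on generalizing T with
  | _ s ihs =>
    by_cases hnd : ∀ L ∈ T, L.Nodup
    swap
    · push Not at hnd
      obtain ⟨L, hL, hn⟩ := hnd
      rw [rowProd_eq_zero hL hn]
      exact Sp.zero_mem
    let g : List (Fin (2 * r)) → List (Fin (2 * r)) :=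
      List.insertionSort fun x y => ordIdx r x ≤ ordIdx r y
    have hg : ∀ L, (g L).Perm L := fun L => List.perm_insertionSort _ L
    have : Std.Total fun x y : Fin (2 * r) => ordIdx r x ≤ ordIdx r y :=
      ⟨fun x y => le_total _ _⟩
    have : IsTrans (Fin (2 * r)) fun x y => ordIdx r x ≤ ordIdx r y :=
      ⟨fun x y z => le_trans⟩
    set T₁ := T.map g with hT₁
    have hlen : T₁.map List.length = T.map List.length := by
      rw [hT₁, List.map_map]
      exact List.map_congr_left fun L _ => (hg L).length_eq
    have hsq : tabSq T₁ = tabSq T := by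
      rw [tabSq, hT₁, List.map_map]
      exact congrArg List.sum (List.map_congr_left fun L _ => by simp [(hg L).length_eq])
    have hwt : tabWeight T₁ = tabWeight T := by
      rw [tabWeight, hT₁, List.map_map]
      exact congrArg List.sum (List.map_congr_left fun L _ => rowWeight_perm (hg L))
    have hlead : leadSum T₁ = leadSum T := leadSum_map g hg T
    have hsize : tabSize T₁ = tabSize T := congrArg List.sum hlen
    have isEvenTab_of_map : ∀ T' : List (List (Fin (2 * r))),
        T'.map List.length = T.map List.length → IsEvenTab T' := by
      intro T' h L hL
      have h1 : L.length ∈ T.map List.length := h ▸ List.mem_map.2 ⟨L, hL, rfl⟩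
      obtain ⟨M, hM, hML⟩ := List.mem_map.1 h1
      rw [← hML]
      exact hE M hM
    have isShape_of_map : ∀ T' : List (List (Fin (2 * r))),
        T'.map List.length = T.map List.length → IsShape T' := by
      intro T' h
      refine ⟨h ▸ hS.1, fun L hL hnil => ?_⟩
      have h1 : L.length ∈ T.map List.length := h ▸ List.mem_map.2 ⟨L, hL, rfl⟩
      obtain ⟨M, hM, hML⟩ := List.mem_map.1 h1
      rw [hnil, List.length_nil, List.length_eq_zero_iff] at hML
      exact hS.2 M hM hML
    have hE₁ := isEvenTab_of_map T₁ hlen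
    have hS₁ := isShape_of_map T₁ hlen
    have hrow : ∀ L ∈ T₁, L.Pairwise fun x y => ordIdx r x < ordIdx r y := by
      intro L hL
      obtain ⟨M, hM, rfl⟩ := List.mem_map.1 hL
      have h1 := List.pairwise_insertionSort (fun x y : Fin (2 * r) => ordIdx r x ≤ ordIdx r y) M
      have h3 : (g M).Nodup := (hg M).nodup_iff.2 (hnd M hM)
      exact (h1.and h3).imp fun {x y} h =>
        lt_of_le_of_ne h.1 fun h' => h.2 (ordIdx_injective h')
    have hmem : rowProd r F T₁ ∈ Sp := by
      by_cases hsy : IsSymplectic r T₁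
      swap
      · simp only [IsSymplectic] at hsy
        push Not at hsy
        obtain ⟨i, t, hi, ht, p, hp, hpe, hlt⟩ := hsy
        have hT : T₁ = T₁.take i ++ T₁[i] :: T₁.drop (i + 1) := by
          rw [← List.drop_eq_getElem_cons hi, List.take_append_drop]
        have hidx : (pairIdx T₁[i][t] : ℕ) = p := by
          rcases hpe with h | h <;> simp [pairIdx, h, hp]
        rw [hT]
        refine rowProd_mem_of_not_symplectic hr hF h2 Sp _ _ _ (hT ▸ hE₁)
          (hrow _ (List.getElem_mem hi)) t ht (hidx ▸ hlt) ?_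
        rw [← hT]
        exact fun T' h1 h3 h4 => ih T' h1 (h3.trans hsize) (Or.inl (hwt ▸ h4))
      by_cases hst : IsStandard r T₁
      · exact hSp T₁ ⟨hS₁, hE₁, hst, hsy⟩
      have hchain : ∀ L ∈ T₁, List.IsChain (fun a b => ordIdx r a < ordIdx r b) L :=
        fun L hL => (hrow L hL).isChain
      have hex : ∃ (i t : ℕ) (hi : i + 1 < T₁.length) (ht' : t < (T₁[i]).length)
          (ht : t < (T₁[i + 1]).length), ordIdx r T₁[i + 1][t] < ordIdx r T₁[i][t] := by
        by_contra! hcon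
        exact hst ⟨hchain, hcon⟩
      obtain ⟨i, t, hi, ht', ht, hlt⟩ := hex
      have hT : T₁ = T₁.take i ++ T₁[i] :: T₁[i + 1] :: T₁.drop (i + 2) := by
        rw [← List.drop_eq_getElem_cons hi, ← List.drop_eq_getElem_cons (Nat.lt_of_succ_lt hi),
          List.take_append_drop]
      have hAB : (T₁[i + 1]).length ≤ (T₁[i]).length := by
        have h : List.IsChain (fun L M => M.length ≤ L.length) T₁ := (List.isChain_map _).1 hS₁.1
        exact List.isChain_iff_getElem.1 h i hi
      rw [hT]
      refine rowProd_mem_of_not_standard Sp _ _ _ _ (hT ▸ hE₁) hAB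
        (hrow _ (List.getElem_mem _)) (hrow _ (List.getElem_mem _)) t ht hlt ?_
      rw [← hT]
      intro T' h1 h3 h4 h5
      rcases h5 with h5 | ⟨h5, h6⟩
      · exact ih T' h1 (h3.trans hsize) (Or.inr ⟨h4.trans hwt, hsq ▸ h5⟩)
      · have h7 := h5.trans hlen
        have h8 : tabSq T' = tabSq T := by
          have := congrArg (fun l : List ℕ => (l.map (· ^ 2)).sum) h7
          simpa [tabSq, List.map_map, Function.comp_def] using this
        refine ihs (leadSum T') (by omega) T' h1 (isShape_of_map T' h7) ?_ rfl
        rw [h3, hsize, h4, hwt, h8]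
        exact ih
    rcases rowProd_map (F := F) g hg T with h | h
    · rwa [← h]
    · rw [← neg_eq_iff_eq_neg.2 h]
      exact Sp.neg_mem hmem

theorem rowProd_mem (hr : 0 < r) (hF : ∀ a ≤ r, (a.factorial : F) ≠ 0)
    (h2 : (2 : F) ≠ 0) (Sp : Submodule F (FV r F))
    (hSp : ∀ T, IsSSET r T → rowProd r F T ∈ Sp) (T : List (List (Fin (2 * r))))
    (hE : IsEvenTab T) : rowProd r F T ∈ Sp := by
  induction hm : (tabSize T * (r + 1) ^ r - tabWeight T) * (tabSize T ^ 2 + 1) +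
    (tabSize T ^ 2 - tabSq T) using Nat.strong_induction_on generalizing T with
  | _ m ihm =>
    let f := T.filter fun L => !L.isEmpty
    let T₁ := f.insertionSort fun L M => M.length ≤ L.length
    have : Std.Total fun L M : List (Fin (2 * r)) => M.length ≤ L.length :=
      ⟨fun x y => le_total _ _⟩
    have : IsTrans (List (Fin (2 * r))) fun L M => M.length ≤ L.length :=
      ⟨fun x y z h h' => le_trans h' h⟩
    have hperm : T₁.Perm f := List.perm_insertionSort _ f
    have hsize : tabSize T₁ = tabSize T :=
      (hperm.map _).sum_eq.trans (sum_map_filter_ne_nil _ rfl T)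
    have hsq : tabSq T₁ = tabSq T := (hperm.map _).sum_eq.trans (sum_map_filter_ne_nil _ rfl T)
    have hwt : tabWeight T₁ = tabWeight T :=
      (hperm.map _).sum_eq.trans (sum_map_filter_ne_nil _ rfl T)
    have hmem : ∀ L ∈ T₁, L ∈ T ∧ L ≠ [] := by
      intro L hL
      simpa [f] using hperm.mem_iff.1 hL
    have hS : IsShape T₁ := by
      refine ⟨?_, fun L hL => (hmem L hL).2⟩
      have h : List.IsChain (fun a b => b ≤ a) (T₁.map List.length) :=
        (List.isChain_map _).2 (List.pairwise_insertionSort _ f).isChain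
      exact h
    rw [← rowProd_filter_ne_nil, ← rowProd_perm F hperm]
    refine rowProd_mem_of_isShape hr hF h2 Sp hSp T₁ (fun L hL => hE L (hmem L hL).1) hS
      fun T' hE' hsz h => ?_
    rw [hsize] at hsz
    rw [hwt, hsq] at h
    refine ihm _ ?_ T' hE' rfl
    have hb1 := tabWeight_le T'
    have hb2 := tabSq_le T'
    rw [hsz] at hb1 hb2 ⊢
    rw [← hm]
    rcases h with h | ⟨h, h'⟩
    · have h3 : tabSize T * (r + 1) ^ r - tabWeight T' + 1 ≤
          tabSize T * (r + 1) ^ r - tabWeight T := by omega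
      have h4 := Nat.mul_le_mul_right (tabSize T ^ 2 + 1) h3
      rw [add_mul, one_mul] at h4
      omega
    · rw [h]
      omega

theorem natCast_ne_zero_of_le (hchar : ringChar F = 0 ∨ r < ringChar F) (a : ℕ) (ha : 0 < a)
    (har : a ≤ r) : (a : F) ≠ 0 := by
  rw [Ne, ringChar.spec]
  intro h
  rcases hchar with h0 | h0
  · rw [h0, zero_dvd_iff] at h
    omega
  · exact absurd (Nat.le_of_dvd ha h) (by omega)

end Induction

/-- For `n = 2r ≥ 4` and a field `F` with `char F = 0` or `char F > r`,
`F[V]` is spanned over `F` by the elements `[T]` for `T` a symplectic standard even-tableau. -/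
theorem span_FV_sset (r : ℕ) (hn : 4 ≤ 2 * r) (F : Type*) [Field F]
    (hchar : ringChar F = 0 ∨ r < ringChar F) :
    Submodule.span F
        (Set.range fun T : {T : List (List (Fin (2 * r))) // IsSSET r T} =>
          tabElem r F T.val) = ⊤ := by
  rw [eq_top_iff, ← span_rowProd_eq_top, Submodule.span_le]
  rintro _ ⟨T, hT, rfl⟩
  refine rowProd_mem (by omega) (fun a ha => ?_) ?_ _ (fun T' hT' => ?_) T hT
  · induction a with
    | zero => simp
    | succ a ih =>
      rw [Nat.factorial_succ, Nat.cast_mul]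
      exact mul_ne_zero (natCast_ne_zero_of_le hchar _ (by omega) ha) (ih (by omega))
  · exact_mod_cast natCast_ne_zero_of_le hchar 2 (by omega) (by omega)
  · exact Submodule.subset_span ⟨⟨T', hT'⟩, tabElem_eq_rowProd F hT'.2.1⟩

end PR
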